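/- arXiv:1903.08331 — 2 statements merged into one kernel-verified Lean document; each statement's English description precedes it below -/
import Mathlib

section
/- For every q ∈ I, the symmetric q-shift (V_q, σ) is a coded system: V_q is the topological closure of an increasing union ∪_{n=1}^∞ X_n of transitive subshifts of finite type X_n ⊆ X_{n+1}. -/
open Classical

/-- The one-sided shift map on sequences. -/
def shift (x : ℕ → ℕ) : ℕ → ℕ := fun i => x (i + 1)

/-- Reflection of a sequence with respect to the alphabet `{0,…,M}`. -/
def reflSeq (M : ℕ) (x : ℕ → ℕ) : ℕ → ℕ := fun i => M - x i

/-- Strict lexicographic order on sequences. -/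
def lexLT (x y : ℕ → ℕ) : Prop := ∃ n : ℕ, (∀ i < n, x i = y i) ∧ x n < y n

/-- Lexicographic order on sequences. -/
def lexLE (x y : ℕ → ℕ) : Prop := x = y ∨ lexLT x y

/-- Strict lexicographic order on words (of the same length). -/
def wordLT (u v : List ℕ) : Prop :=
  ∃ n : ℕ, n < u.length ∧ (∀ i < n, u.getD i 0 = v.getD i 0) ∧ u.getD n 0 < v.getD n 0

/-- Lexicographic order on words (of the same length). -/
def wordLE (u v : List ℕ) : Prop := u = v ∨ wordLT u v

/-- Membership in the full shift over the alphabet `{0,…,M}`. -/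
def memSigma (M : ℕ) (x : ℕ → ℕ) : Prop := ∀ i, x i ≤ M

/-- `a` is the quasi-greedy expansion of `1` in base `q` over the alphabet `{0,…,M}`:
the lexicographically largest sequence with infinitely many nonzero entries satisfying
`∑ a_i q^{-i} = 1`. -/
def IsQuasiGreedy (M : ℕ) (q : ℝ) (a : ℕ → ℕ) : Prop :=
  memSigma M a ∧ (∀ n, ∃ m ≥ n, a m ≠ 0) ∧ (∑' i : ℕ, (a i : ℝ) / q ^ (i + 1)) = 1 ∧
    ∀ b : ℕ → ℕ, memSigma M b → (∀ n, ∃ m ≥ n, b m ≠ 0) →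
      (∑' i : ℕ, (b i : ℝ) / q ^ (i + 1)) = 1 → lexLE b a

/-- The quasi-greedy expansion of `1` in base `q` (as a global function, via choice). -/
noncomputable def qg (M : ℕ) (q : ℝ) : ℕ → ℕ :=
  if h : ∃ a, IsQuasiGreedy M q a then h.choose else fun _ => 0

/-- The set `V` of sequences `a` with `ā ≼ σⁿ(a) ≼ a` for all `n ≥ 0`. -/
def memV (M : ℕ) (a : ℕ → ℕ) : Prop :=
  memSigma M a ∧ ∀ n : ℕ, lexLE (reflSeq M a) (shift^[n] a) ∧ lexLE (shift^[n] a) a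

/-- The set `V_L` of bases `q ∈ (1, M+1]` with `α(q) ∈ V`. -/
def memVL (M : ℕ) (q : ℝ) : Prop := 1 < q ∧ q ≤ M + 1 ∧ memV M (qg M q)

/-- The symmetric `q`-shift `V_q`. -/
def Vq (M : ℕ) (q : ℝ) : Set (ℕ → ℕ) :=
  {x | memSigma M x ∧
    ∀ n : ℕ, lexLE (reflSeq M (qg M q)) (shift^[n] x) ∧ lexLE (shift^[n] x) (qg M q)}

/-- The word `w` occurs as a factor of the sequence `x`. -/
def IsFactorOf (w : List ℕ) (x : ℕ → ℕ) : Prop :=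
  ∃ k : ℕ, ∀ i < w.length, x (k + i) = w.getD i 0

/-- Membership in the language of a subshift `X`. -/
def InLang (X : Set (ℕ → ℕ)) (w : List ℕ) : Prop := ∃ x ∈ X, IsFactorOf w x

/-- The set of admissible words of length `k` of a subshift `X`. -/
def Bn (X : Set (ℕ → ℕ)) (k : ℕ) : Set (List ℕ) := {w | w.length = k ∧ InLang X w}

/-- The specification property. -/
def HasSpecification (X : Set (ℕ → ℕ)) : Prop :=
  ∃ S : ℕ, ∀ u v : List ℕ, InLang X u → InLang X v →
    ∃ w : List ℕ, w.length = S ∧ InLang X (u ++ w ++ v)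

/-- Topological transitivity (language formulation). -/
def IsTransitive (X : Set (ℕ → ℕ)) : Prop :=
  ∀ u v : List ℕ, InLang X u → InLang X v → ∃ w : List ℕ, InLang X (u ++ w ++ v)

/-- Topological mixing (language formulation). -/
def IsMixing (X : Set (ℕ → ℕ)) : Prop :=
  ∀ u v : List ℕ, InLang X u → InLang X v →
    ∃ N : ℕ, ∀ n ≥ N, ∃ w : List ℕ, w.length = n ∧ InLang X (u ++ w ++ v)

/-- Intrinsically synchronising word. -/
def IntrinsicallySynchronising (X : Set (ℕ → ℕ)) (w : List ℕ) : Prop :=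
  ∀ u v : List ℕ, InLang X (u ++ w) → InLang X (w ++ v) → InLang X (u ++ w ++ v)

/-- Synchronised subshift: transitive with an intrinsically synchronising word. -/
def IsSynchronised (X : Set (ℕ → ℕ)) : Prop :=
  IsTransitive X ∧ ∃ w : List ℕ, InLang X w ∧ IntrinsicallySynchronising X w

/-- Subshift of finite type over `{0,…,M}`: determined by a finite set of forbidden words. -/
def IsSFT (M : ℕ) (X : Set (ℕ → ℕ)) : Prop :=
  ∃ F : Finset (List ℕ), X = {x | memSigma M x ∧ ∀ w ∈ F, ¬ IsFactorOf w x}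

/-- Coded system: the closure of an increasing union of transitive subshifts of finite type. -/
def IsCoded (M : ℕ) (X : Set (ℕ → ℕ)) : Prop :=
  ∃ Y : ℕ → Set (ℕ → ℕ), (∀ n, IsSFT M (Y n) ∧ IsTransitive (Y n)) ∧
    (∀ n, Y n ⊆ Y (n + 1)) ∧ X = closure (⋃ n, Y n)

/-- `ω⁻`: decrease the last letter of a word by one. -/
def wMinus (w : List ℕ) : List ℕ := w.dropLast ++ [w.getLast! - 1]

/-- `ω⁺`: increase the last letter of a word by one. -/
def wPlus (w : List ℕ) : List ℕ := w.dropLast ++ [w.getLast! + 1]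

/-- Reflection of a word. -/
def wRefl (M : ℕ) (w : List ℕ) : List ℕ := w.map (fun c => M - c)

/-- `ω^∞`: the periodic sequence repeating the word `w`. -/
def perSeq (w : List ℕ) : ℕ → ℕ := fun i => w.getD (i % w.length) 0

/-- The sequence beginning with the word `u` followed by the periodic sequence `v^∞`. -/
def wordThenPer (u v : List ℕ) : ℕ → ℕ :=
  fun i => if i < u.length then u.getD i 0 else perSeq v (i - u.length)

/-- The prefix of length `n` of a sequence, as a word. -/
def prefixWord (a : ℕ → ℕ) (n : ℕ) : List ℕ := (List.range n).map a

/-- A sequence `a ∈ V` is irreducible if `a_1…a_j (\overline{a_1…a_j}⁺)^∞ ≺ a`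
whenever `(a_1…a_j⁻)^∞ ∈ V`. -/
def IrreducibleSeq (M : ℕ) (a : ℕ → ℕ) : Prop :=
  ∀ j : ℕ, 1 ≤ j → memV M (perSeq (wMinus (prefixWord a j))) →
    lexLT (wordThenPer (prefixWord a j) (wPlus (wRefl M (prefixWord a j)))) a

/-- The set `I` of irreducible bases. -/
def memI (M : ℕ) (q : ℝ) : Prop := memVL M q ∧ IrreducibleSeq M (qg M q)

/-- The set `U` of univoque bases. -/
def memU (M : ℕ) (q : ℝ) : Prop :=
  (1 < q ∧ q < M + 1 ∧ ∀ n : ℕ, 1 ≤ n →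
      lexLT (reflSeq M (qg M q)) (shift^[n] (qg M q)) ∧
        lexLT (shift^[n] (qg M q)) (qg M q)) ∨ q = M + 1

/-- The set `U̅`: closure of the set of univoque bases. -/
def memUbar (M : ℕ) (q : ℝ) : Prop :=
  1 < q ∧ q ≤ M + 1 ∧
    ∀ n : ℕ, lexLT (reflSeq M (qg M q)) (shift^[n] (qg M q)) ∧
      lexLE (shift^[n] (qg M q)) (qg M q)

/-- The indices `n_m` of the natural approximation from below (`approxIdx M q 0 = n_1`). -/
noncomputable def approxIdx (M : ℕ) (q : ℝ) : ℕ → ℕ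
  | 0 => sInf {n : ℕ | 1 ≤ n ∧ memV M (perSeq (wMinus (prefixWord (qg M q) n)))}
  | m + 1 => sInf {n : ℕ | approxIdx M q m < n ∧ memV M (perSeq (wMinus (prefixWord (qg M q) n)))}

/-- The base in `(1, M+1]` whose quasi-greedy expansion is `a` (via choice). -/
noncomputable def baseOf (M : ℕ) (a : ℕ → ℕ) : ℝ :=
  if h : ∃ q : ℝ, 1 < q ∧ q ≤ M + 1 ∧ qg M q = a then h.choose else 0

/-- The natural approximation from below of `q` (`approxBase M q 0 = q_1⁻`),
determined by `α(q_m⁻) = (α_1(q)…α_{n_m}(q)⁻)^∞`. -/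
noncomputable def approxBase (M : ℕ) (q : ℝ) (m : ℕ) : ℝ :=
  baseOf M (perSeq (wMinus (prefixWord (qg M q) (approxIdx M q m))))

/-- Strongly irreducible base: `q ∈ I` and all but finitely many terms of the natural
approximation from below lie in `I`. -/
def memSI (M : ℕ) (q : ℝ) : Prop :=
  memI M q ∧ ∃ N : ℕ, ∀ m ≥ N, memI M (approxBase M q m)

/-- Weakly irreducible base: `q ∈ I` but infinitely many terms of the natural
approximation from below are not in `I`. -/
def memWI (M : ℕ) (q : ℝ) : Prop :=
  memI M q ∧ ∀ N : ℕ, ∃ m ≥ N, ¬ memI M (approxBase M q m)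

/-- The generalised golden ratio `q_G(M)`. -/
noncomputable def qG (M : ℕ) : ℝ :=
  if M % 2 = 0 then ((M / 2 : ℕ) : ℝ) + 1
  else (((M / 2 : ℕ) : ℝ) + 1 +
    Real.sqrt (((M / 2 : ℕ) : ℝ) ^ 2 + 6 * ((M / 2 : ℕ) : ℝ) + 5)) / 2

/-- The metric on `Σ_M`: `d(x,y) = 2^{-j}` where `j` is the first (1-indexed) place
where `x` and `y` differ. -/
noncomputable def seqDist (x y : ℕ → ℕ) : ℝ :=
  if x = y then 0 else (1 / 2 : ℝ) ^ (sInf {i : ℕ | x i ≠ y i} + 1)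

/-- Fundamental word (Allaart). -/
def IsFundamentalWord (M : ℕ) (w : List ℕ) : Prop :=
  2 < w.length ∧ ∀ i : ℕ, 1 ≤ i → i ≤ w.length - 1 →
    wordLE (wRefl M (w.take (w.length - i))) (w.drop i) ∧
      wordLT (w.drop i) (w.take (w.length - i))

/-- The set `I_N`. -/
def memIN (M N : ℕ) (q : ℝ) : Prop :=
  memVL M q ∧
    prefixWord (qg M q) (2 * N) = List.replicate (2 * N - 1) M ++ [0] ∧
    ∀ r : ℕ, 2 ≤ r →
      wordLT (List.replicate N 0) ((List.range N).map (fun i => qg M q (r * N + i))) ∧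
      wordLT ((List.range N).map (fun i => qg M q (r * N + i))) (List.replicate N M)

/-- The (forward) orbit of a sequence under the shift. -/
def orbit (a : ℕ → ℕ) : Set (ℕ → ℕ) := {y | ∃ n : ℕ, y = shift^[n] a}


/-- The sequence `x_0 … x_{L-1}` followed by `y`. -/
def joinSeq (L : ℕ) (x y : ℕ → ℕ) : ℕ → ℕ := fun i => if i < L then x i else y (i - L)

theorem joinSeq_of_lt {L i : ℕ} (x y : ℕ → ℕ) (h : i < L) : joinSeq L x y i = x i := by
  simp [joinSeq, h]

theorem joinSeq_add (L i : ℕ) (x y : ℕ → ℕ) : joinSeq L x y (L + i) = y i := by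
  simp [joinSeq]

theorem joinSeq_of_le {L i : ℕ} (x y : ℕ → ℕ) (h : L ≤ i) : joinSeq L x y i = y (i - L) := by
  simp [joinSeq, Nat.not_lt.2 h]

theorem iterate_shift (n : ℕ) (x : ℕ → ℕ) : shift^[n] x = fun i => x (n + i) := by
  induction n generalizing x with
  | zero => simp
  | succ n ih =>
    rw [Function.iterate_succ_apply, ih]
    funext i
    simp only [shift]
    congr 1
    omega

theorem lexLE_iff (x y : ℕ → ℕ) :
    lexLE x y ↔ ∀ m, (∀ i < m, x i = y i) → x m ≤ y m := by
  constructor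
  · rintro (rfl | ⟨n, hn, hlt⟩) m hm
    · exact le_rfl
    · rcases lt_trichotomy m n with h | h | h
      · exact (hn m h).le
      · subst h
        exact hlt.le
      · exact absurd (hm n h) hlt.ne
  · intro h
    by_cases hxy : x = y
    · exact Or.inl hxy
    · right
      have hex : ∃ i, x i ≠ y i := by
        by_contra hcon
        push Not at hcon
        exact hxy (funext hcon)
      have hmin : ∀ i < Nat.find hex, x i = y i := fun i hi => by
        simpa using Nat.find_min hex hi
      exact ⟨Nat.find hex, hmin, lt_of_le_of_ne (h _ hmin) (Nat.find_spec hex)⟩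

/-- All shifts of `x` are lexicographically at most `a` and at least the reflection of `a`. -/
def Admissible (M : ℕ) (a x : ℕ → ℕ) : Prop :=
  memSigma M x ∧ (∀ t m, (∀ i < m, x (t + i) = a i) → x (t + m) ≤ a m) ∧
    ∀ t m, (∀ i < m, x (t + i) + a i = M) → M ≤ x (t + m) + a m

theorem admissible_iff {M : ℕ} {a : ℕ → ℕ} (ha : memSigma M a) (x : ℕ → ℕ) :
    Admissible M a x ↔ memSigma M x ∧
      ∀ n : ℕ, lexLE (reflSeq M a) (shift^[n] x) ∧ lexLE (shift^[n] x) a := by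
  simp only [lexLE_iff, iterate_shift, reflSeq, Admissible]
  constructor
  · rintro ⟨h0, h1, h2⟩
    refine ⟨h0, fun n => ⟨fun m hm => ?_, h1 n⟩⟩
    have := h2 n m (fun i hi => by have := hm i hi; have := ha i; omega)
    omega
  · rintro ⟨h0, h1⟩
    refine ⟨h0, fun n => (h1 n).2, fun t m hm => ?_⟩
    have := (h1 t).1 m (fun i hi => by have := hm i hi; omega)
    omega

theorem mem_closure_iff_forall_agree (S : Set (ℕ → ℕ)) (x : ℕ → ℕ) :
    x ∈ closure S ↔ ∀ N, ∃ y ∈ S, ∀ i < N, y i = x i := by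
  rw [(PiNat.isTopologicalBasis_cylinders (fun _ : ℕ => ℕ)).mem_closure_iff]
  constructor
  · intro h N
    obtain ⟨y, hy, hyS⟩ := h (PiNat.cylinder x N) ⟨x, N, rfl⟩ (PiNat.self_mem_cylinder x N)
    exact ⟨y, hyS, hy⟩
  · rintro h o ⟨z, N, rfl⟩ hx
    obtain ⟨y, hyS, hy⟩ := h N
    exact ⟨y, fun i hi => (hy i hi).trans (hx i hi), hyS⟩

theorem closure_subset_admissible {M : ℕ} {a : ℕ → ℕ} {S : Set (ℕ → ℕ)}
    (hS : ∀ x ∈ S, Admissible M a x) {x : ℕ → ℕ} (hx : x ∈ closure S) : Admissible M a x := by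
  rw [mem_closure_iff_forall_agree] at hx
  refine ⟨fun i => ?_, fun t m hm => ?_, fun t m hm => ?_⟩
  · obtain ⟨y, hy, hyx⟩ := hx (i + 1)
    rw [← hyx i (by omega)]
    exact (hS y hy).1 i
  · obtain ⟨y, hy, hyx⟩ := hx (t + m + 1)
    rw [← hyx _ (by omega)]
    exact (hS y hy).2.1 t m fun i hi => by rw [hyx _ (by omega)]; exact hm i hi
  · obtain ⟨y, hy, hyx⟩ := hx (t + m + 1)
    rw [← hyx _ (by omega)]
    exact (hS y hy).2.2 t m fun i hi => by rw [hyx _ (by omega)]; exact hm i hi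

/-- At the place `i` the sequence `x` behaves like the balanced sequence, which is constant for
even `M` and alternates between the two middle digits for odd `M`. -/
def BalancedAt (M : ℕ) (x : ℕ → ℕ) (i : ℕ) : Prop :=
  (x i = M / 2 ∨ x i = M - M / 2) ∧ x i + x (i + 1) = M

/-- Prepend a middle digit to `x`, on the other side of the middle than `x 0`. -/
def balPrepend (M : ℕ) (x : ℕ → ℕ) : ℕ → ℕ
  | 0 => if M - M / 2 ≤ x 0 then M / 2 else M - M / 2
  | i + 1 => x i

/-- The sequences all of whose windows of length `n` are prefixes of elements of `H`. -/
def windowShift (n : ℕ) (H : Set (ℕ → ℕ)) : Set (ℕ → ℕ) :=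
  {x | ∀ t, ∃ y ∈ H, ∀ i < n, y i = x (t + i)}

theorem windowShift_isSFT {M n : ℕ} {H : Set (ℕ → ℕ)} (hn : 0 < n)
    (hsig : ∀ x ∈ H, memSigma M x) : IsSFT M (windowShift n H) := by
  refine ⟨((Finset.univ : Finset (Fin n → Fin (M + 1))).image
    (fun f => List.ofFn (fun i => (f i : ℕ)))).filter
      (fun w => ¬ ∃ y ∈ H, ∀ i < n, y i = w.getD i 0), ?_⟩
  ext x
  simp only [windowShift, Set.mem_ofPred_eq, Finset.mem_filter, Finset.mem_image,
    Finset.mem_univ, true_and]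
  constructor
  · intro h
    refine ⟨fun t => ?_, ?_⟩
    · obtain ⟨y, hy, hyx⟩ := h t
      have := hyx 0 hn
      simp only [add_zero] at this
      rw [← this]
      exact hsig y hy 0
    · rintro w ⟨⟨f, rfl⟩, hw⟩ ⟨t, ht⟩
      obtain ⟨y, hy, hyx⟩ := h t
      exact hw ⟨y, hy, fun i hi => by rw [hyx i hi]; exact ht i (by simpa using hi)⟩
  · rintro ⟨hx, h⟩ t
    by_contra hcon
    have key : ∀ i < n, (List.ofFn (fun i : Fin n => x (t + i))).getD i 0 = x (t + i) := by
      intro i hi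
      simp [List.getD_eq_getElem?_getD, hi]
    refine h (List.ofFn (fun i : Fin n => x (t + i)))
      ⟨⟨fun i => ⟨x (t + i), Nat.lt_succ_of_le (hx _)⟩, rfl⟩, ?_⟩ ⟨t, fun i hi => ?_⟩
    · rintro ⟨y, hy, hyx⟩
      exact hcon ⟨y, hy, fun i hi => by rw [hyx i hi, key i hi]⟩
    · rw [key i (by simpa using hi)]

theorem tail_mem {H : Set (ℕ → ℕ)} (hshift : ∀ x ∈ H, shift x ∈ H) {x : ℕ → ℕ} (hx : x ∈ H)
    (t : ℕ) : (fun i => x (t + i)) ∈ H := by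
  rw [← iterate_shift]
  induction t with
  | zero => simpa
  | succ t ih => rw [Function.iterate_succ_apply']; exact hshift _ ih

theorem subset_windowShift {n : ℕ} {H : Set (ℕ → ℕ)} (hshift : ∀ x ∈ H, shift x ∈ H) :
    H ⊆ windowShift n H :=
  fun _ hx t => ⟨_, tail_mem hshift hx t, fun _ _ => rfl⟩

theorem windowShift_isTransitive {M n : ℕ} {H : Set (ℕ → ℕ)} (hn : 0 < n)
    (hshift : ∀ x ∈ H, shift x ∈ H) (hbal : ∀ x ∈ H, ∃ K, ∀ i ≥ K, BalancedAt M x i)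
    (hpre : ∀ x ∈ H, balPrepend M x ∈ H) : IsTransitive (windowShift n H) := by
  rintro u v ⟨x₀, hx₀, k, hk⟩ ⟨y₀, hy₀, l, hl⟩
  set x : ℕ → ℕ := fun i => x₀ (k + i) with hxdef
  set y : ℕ → ℕ := fun i => y₀ (l + i) with hydef
  have hx : ∀ t, ∃ z ∈ H, ∀ i < n, z i = x (t + i) := fun t => by
    simpa [hxdef, add_assoc] using hx₀ (k + t)
  have hy : ∀ t, ∃ z ∈ H, ∀ i < n, z i = y (t + i) := fun t => by
    simpa [hydef, add_assoc] using hy₀ (l + t)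
  obtain ⟨z, hz, hzx⟩ := hx u.length
  obtain ⟨K, hK⟩ := hbal z hz
  set p := joinSeq u.length x z with hp
  have hpw : ∀ t, ∃ w ∈ H, ∀ i < n, w i = p (t + i) := by
    intro t
    rcases le_or_gt u.length t with h | h
    · refine ⟨_, tail_mem hshift hz (t - u.length), fun i _ => ?_⟩
      rw [hp, joinSeq_of_le _ _ (by omega)]
      congr 1
      omega
    · obtain ⟨w, hw, hwx⟩ := hx t
      refine ⟨w, hw, fun i hi => ?_⟩
      rw [hwx i hi]
      rcases lt_or_ge (t + i) u.length with h' | h'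
      · rw [hp, joinSeq_of_lt _ _ h']
      · rw [hp, joinSeq_of_le _ _ h', hzx _ (by omega)]
        congr 1
        omega
  have hpb : ∀ i ≥ u.length + K, BalancedAt M p i := by
    intro i hi
    have := hK (i - u.length) (by omega)
    unfold BalancedAt at this ⊢
    rw [hp, joinSeq_of_le _ _ (by omega), joinSeq_of_le _ _ (by omega)]
    rwa [show i + 1 - u.length = i - u.length + 1 by omega]
  -- choose the length of the balanced block according to the phase of `y`
  obtain ⟨L, hLK, hL⟩ : ∃ L, u.length + K + n ≤ L ∧ p L = balPrepend M y 0 := by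
    have h1 := hpb (u.length + K + n) (by omega)
    have h2 := hpb (u.length + K + n + 1) (by omega)
    by_cases h : p (u.length + K + n) = balPrepend M y 0
    · exact ⟨_, le_rfl, h⟩
    · refine ⟨u.length + K + n + 1, by omega, ?_⟩
      unfold BalancedAt at h1 h2
      simp only [balPrepend] at h ⊢
      split_ifs at h ⊢ <;> omega
  set r := joinSeq (L + 1) p y with hr
  have hblock : ∀ c, c ≤ L + 1 - (u.length + K) → ∃ w ∈ H, ∀ i < n, w i = r (L + 1 - c + i) := by
    intro c
    induction c with
    | zero =>
      intro _
      obtain ⟨w, hw, hwy⟩ := hy 0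
      refine ⟨w, hw, fun i hi => ?_⟩
      rw [hwy i hi, Nat.sub_zero, hr, joinSeq_add, zero_add]
    | succ c ih =>
      intro hc
      obtain ⟨w, hw, hwr⟩ := ih (by omega)
      refine ⟨_, hpre w hw, fun i hi => ?_⟩
      cases i with
      | zero =>
        have hw0 := hwr 0 hn
        simp only [add_zero] at hw0 ⊢
        simp only [balPrepend]
        rw [hw0]
        have e1 : r (L + 1 - (c + 1)) = p (L - c) := by
          rw [hr, joinSeq_of_lt _ _ (by omega)]
          congr 1
          omega
        rw [e1]
        rcases Nat.eq_zero_or_pos c with rfl | hc0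
        · have e2 : r (L + 1 - 0) = y 0 := by
            rw [hr, joinSeq_of_le _ _ (by omega)]
            simp
          rw [e2, Nat.sub_zero, hL]
          simp only [balPrepend]
        · have e2 : r (L + 1 - c) = p (L - c + 1) := by
            rw [hr, joinSeq_of_lt _ _ (by omega)]
            congr 1
            omega
          have h1 := hpb (L - c) (by omega)
          have h2 := hpb (L - c + 1) (by omega)
          rw [e2]
          unfold BalancedAt at h1 h2
          split_ifs <;> omega
      | succ i =>
        simp only [balPrepend]
        rw [hwr i (by omega)]
        congr 1
        omega
  have hrw : r ∈ windowShift n H := by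
    intro t
    rcases le_or_gt (L + 1) t with h | h
    · obtain ⟨w, hw, hwy⟩ := hy (t - (L + 1))
      refine ⟨w, hw, fun i hi => ?_⟩
      rw [hwy i hi, hr, joinSeq_of_le _ _ (by omega)]
      congr 1
      omega
    · rcases le_or_gt (u.length + K) t with h' | h'
      · have := hblock (L + 1 - t) (by omega)
        rwa [show L + 1 - (L + 1 - t) = t by omega] at this
      · obtain ⟨w, hw, hwp⟩ := hpw t
        refine ⟨w, hw, fun i hi => ?_⟩
        rw [hwp i hi, hr, joinSeq_of_lt _ _ (by omega)]
  refine ⟨(List.range (L + 1 - u.length)).map (fun i => r (u.length + i)), r, hrw, 0, ?_⟩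
  intro i hi
  simp only [List.length_append, List.length_map, List.length_range] at hi
  rw [zero_add]
  rcases lt_or_ge i u.length with h1 | h1
  · rw [List.append_assoc, List.getD_append _ _ _ _ h1, ← hk i h1, hr,
      joinSeq_of_lt _ _ (by omega), hp, joinSeq_of_lt _ _ h1]
  · rcases lt_or_ge i (L + 1) with h2 | h2
    · rw [List.append_assoc, List.getD_append_right _ _ _ _ h1,
        List.getD_append _ _ _ _ (by simp; omega), List.getD_eq_getElem _ _ (by simp; omega)]
      simp only [List.getElem_map, List.getElem_range]
      congr 1
      omega
    · rw [List.getD_append_right _ _ _ _ (by simp; omega), hr, joinSeq_of_le _ _ h2]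
      simp only [List.length_append, List.length_map, List.length_range]
      rw [show u.length + (L + 1 - u.length) = L + 1 by omega, ← hl _ (by omega)]

theorem isCoded_closure_iUnion {M : ℕ} {H : ℕ → Set (ℕ → ℕ)} (hmono : ∀ n, H n ⊆ H (n + 1))
    (hsig : ∀ n, ∀ x ∈ H n, memSigma M x) (hshift : ∀ n, ∀ x ∈ H n, shift x ∈ H n)
    (hbal : ∀ n, ∀ x ∈ H n, ∃ K, ∀ i ≥ K, BalancedAt M x i)
    (hpre : ∀ n, ∀ x ∈ H n, balPrepend M x ∈ H n)
    (hloc : ∀ n x, shift x ∈ H n → (∃ y ∈ H n, ∀ i < n + 2, y i = x i) → x ∈ H n) :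
    IsCoded M (closure (⋃ n, H n)) := by
  have hY : ∀ n, windowShift (n + 2) (H n) ⊆ windowShift (n + 1 + 2) (H (n + 1)) := by
    intro n x hx t
    obtain ⟨y, hy, hyx⟩ := hx t
    obtain ⟨z, hz, hzx⟩ := hx (t + 1)
    have hcons : ∀ i < n + 1 + 2, joinSeq 1 y z i = x (t + i) := by
      intro i hi
      rcases Nat.eq_zero_or_pos i with rfl | h
      · rw [joinSeq_of_lt _ _ (by omega), hyx 0 (by omega)]
      · rw [joinSeq_of_le _ _ h, hzx _ (by omega)]
        congr 1
        omega
    refine ⟨joinSeq 1 y z, hmono n (hloc n _ ?_ ⟨y, hy, fun i hi => ?_⟩), hcons⟩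
    · have : shift (joinSeq 1 y z) = z := by
        funext i
        rw [shift, add_comm, joinSeq_add]
      rwa [this]
    · rw [hyx i hi, hcons i (by omega)]
  refine ⟨fun n => windowShift (n + 2) (H n), fun n => ⟨windowShift_isSFT (by omega) (hsig n),
    windowShift_isTransitive (by omega) (hshift n) (hbal n) (hpre n)⟩, hY, ?_⟩
  apply Set.Subset.antisymm
  · exact closure_mono (Set.iUnion_mono fun n => subset_windowShift (hshift n))
  · refine closure_minimal ?_ isClosed_closure
    intro x hx
    obtain ⟨n, hn⟩ := Set.mem_iUnion.1 hx
    rw [mem_closure_iff_forall_agree]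
    intro N
    have hmN := monotone_nat_of_le_succ (f := fun n => windowShift (n + 2) (H n)) hY
    obtain ⟨y, hy, hyx⟩ := hmN (le_max_left n N) hn 0
    refine ⟨y, Set.mem_iUnion.2 ⟨_, hy⟩, fun i hi => ?_⟩
    rw [hyx i (by have := le_max_right n N; omega), zero_add]

/-- The tail of `x` at `t` is smaller than `a`, as seen on the first `N` digits. -/
def UpLT (a x : ℕ → ℕ) (t N : ℕ) : Prop := ∃ m < N, (∀ i < m, x (t + i) = a i) ∧ x (t + m) < a m

/-- The tail of `x` at `t` is larger than the reflection of `a`, as seen on the first `N` digits. -/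
def LoGT (M : ℕ) (a x : ℕ → ℕ) (t N : ℕ) : Prop :=
  ∃ m < N, (∀ i < m, x (t + i) + a i = M) ∧ M < x (t + m) + a m

theorem UpLT.mono {a x : ℕ → ℕ} {t N N' : ℕ} (h : UpLT a x t N) (hN : N ≤ N') : UpLT a x t N' := by
  obtain ⟨m, hm, h⟩ := h
  exact ⟨m, by omega, h⟩

theorem LoGT.mono {M : ℕ} {a x : ℕ → ℕ} {t N N' : ℕ} (h : LoGT M a x t N) (hN : N ≤ N') :
    LoGT M a x t N' := by
  obtain ⟨m, hm, h⟩ := h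
  exact ⟨m, by omega, h⟩

theorem UpLT.congr {a x y : ℕ → ℕ} {s t N : ℕ} (h : UpLT a x s N)
    (hxy : ∀ i < N, y (t + i) = x (s + i)) : UpLT a y t N := by
  obtain ⟨m, hm, h1, h2⟩ := h
  exact ⟨m, hm, fun i hi => by rw [hxy i (by omega), h1 i hi], by rwa [hxy m hm]⟩

theorem LoGT.congr {M : ℕ} {a x y : ℕ → ℕ} {s t N : ℕ} (h : LoGT M a x s N)
    (hxy : ∀ i < N, y (t + i) = x (s + i)) : LoGT M a y t N := by
  obtain ⟨m, hm, h1, h2⟩ := h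
  exact ⟨m, hm, fun i hi => by rw [hxy i (by omega), h1 i hi], by rwa [hxy m hm]⟩

theorem upLT_or_eq {M : ℕ} {a x : ℕ → ℕ} (hx : Admissible M a x) (t N : ℕ) :
    UpLT a x t N ∨ ∀ i < N, x (t + i) = a i := by
  induction N with
  | zero => exact Or.inr fun i hi => absurd hi (Nat.not_lt_zero i)
  | succ N ih =>
    rcases ih with h | h
    · exact Or.inl (h.mono (Nat.le_succ N))
    · rcases (hx.2.1 t N h).lt_or_eq with h' | h'
      · exact Or.inl ⟨N, Nat.lt_succ_self N, h, h'⟩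
      · exact Or.inr fun i hi => (Nat.lt_succ_iff_lt_or_eq.1 hi).elim (h i) fun e => e ▸ h'

theorem loGT_or_eq {M : ℕ} {a x : ℕ → ℕ} (hx : Admissible M a x) (t N : ℕ) :
    LoGT M a x t N ∨ ∀ i < N, x (t + i) + a i = M := by
  induction N with
  | zero => exact Or.inr fun i hi => absurd hi (Nat.not_lt_zero i)
  | succ N ih =>
    rcases ih with h | h
    · exact Or.inl (h.mono (Nat.le_succ N))
    · rcases (hx.2.2 t N h).lt_or_eq with h' | h'
      · exact Or.inl ⟨N, Nat.lt_succ_self N, h, h'⟩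
      · exact Or.inr fun i hi => (Nat.lt_succ_iff_lt_or_eq.1 hi).elim (h i) fun e => e ▸ h'.symm

/-- Sequences ending in the balanced sequence, all of whose tails lie strictly between `a` and its
reflection. -/
def StrictBalanced (M : ℕ) (a x : ℕ → ℕ) : Prop :=
  memSigma M x ∧ (∀ t, (∃ N, UpLT a x t N) ∧ ∃ N, LoGT M a x t N) ∧
    ∃ K, ∀ i ≥ K, BalancedAt M x i

/-- The sequence `a` is large enough for the middle digits to be neutral. -/
def Wide (M : ℕ) (a : ℕ → ℕ) : Prop :=
  M - M / 2 < a 0 ∨ (a 0 = M - M / 2 ∧ M / 2 < M - M / 2 ∧ a 1 = M - M / 2)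

theorem BalancedAt.upLT {M : ℕ} {a x : ℕ → ℕ} {t : ℕ} (hw : Wide M a) (h : BalancedAt M x t) :
    UpLT a x t 2 := by
  unfold BalancedAt at h
  by_cases h0 : x t < a 0
  · exact ⟨0, by omega, fun i hi => absurd hi (Nat.not_lt_zero i), h0⟩
  · refine ⟨1, by omega, fun i hi => ?_, ?_⟩
    · obtain rfl : i = 0 := by omega
      rw [add_zero]
      rcases hw with hw | hw <;> omega
    · rcases hw with hw | hw <;> omega

theorem BalancedAt.loGT {M : ℕ} {a x : ℕ → ℕ} {t : ℕ} (hw : Wide M a) (h : BalancedAt M x t) :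
    LoGT M a x t 2 := by
  unfold BalancedAt at h
  by_cases h0 : M < x t + a 0
  · exact ⟨0, by omega, fun i hi => absurd hi (Nat.not_lt_zero i), h0⟩
  · refine ⟨1, by omega, fun i hi => ?_, ?_⟩
    · obtain rfl : i = 0 := by omega
      rw [add_zero]
      rcases hw with hw | hw <;> omega
    · rcases hw with hw | hw <;> omega

theorem memSigma_of_balanced {M : ℕ} {x : ℕ → ℕ} (h : ∀ i, BalancedAt M x i) : memSigma M x := by
  intro i
  have := h i
  unfold BalancedAt at this
  omega

theorem strictBalanced_of_balanced {M : ℕ} {a x : ℕ → ℕ} (hw : Wide M a)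
    (h : ∀ i, BalancedAt M x i) : StrictBalanced M a x :=
  ⟨memSigma_of_balanced h, fun t => ⟨⟨2, (h t).upLT hw⟩, ⟨2, (h t).loGT hw⟩⟩, 0, fun i _ => h i⟩

/-- The balanced sequence starting with `M / 2`. -/
def balSeq (M : ℕ) : ℕ → ℕ := fun i => if i % 2 = 0 then M / 2 else M - M / 2

theorem balSeq_balanced (M i : ℕ) : BalancedAt M (balSeq M) i := by
  unfold BalancedAt balSeq
  split_ifs <;> omega

theorem StrictBalanced.tail {M : ℕ} {a x : ℕ → ℕ} (h : StrictBalanced M a x) (n : ℕ) :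
    StrictBalanced M a (fun i => x (n + i)) := by
  obtain ⟨h0, h1, K, hK⟩ := h
  refine ⟨fun i => h0 _, fun t => ?_, K, fun i hi => hK (n + i) (by omega)⟩
  obtain ⟨⟨N, hN⟩, N', hN'⟩ := h1 (n + t)
  exact ⟨⟨N, hN.congr fun i _ => by simp only [add_assoc]⟩,
    ⟨N', hN'.congr fun i _ => by simp only [add_assoc]⟩⟩

theorem StrictBalanced.refl {M : ℕ} {a x : ℕ → ℕ} (ha : memSigma M a)
    (h : StrictBalanced M a x) : StrictBalanced M a (reflSeq M x) := by
  obtain ⟨h0, h1, K, hK⟩ := h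
  refine ⟨fun i => Nat.sub_le _ _, fun t => ?_, K, fun i hi => ?_⟩
  · obtain ⟨⟨N, m, hm, hu, hu'⟩, N', m', hm', hl, hl'⟩ := h1 t
    refine ⟨⟨N', m', hm', fun i hi => ?_, ?_⟩, ⟨N, m, hm, fun i hi => ?_, ?_⟩⟩
    · have := hl i hi
      simp only [reflSeq]
      omega
    · have := h0 (t + m')
      simp only [reflSeq]
      omega
    · have := hu i hi
      have := ha i
      simp only [reflSeq]
      omega
    · have := ha m
      simp only [reflSeq]
      omega
  · have h1 := hK i hi
    have h2 := hK (i + 1) (by omega)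
    unfold BalancedAt at h1 h2 ⊢
    simp only [reflSeq]
    omega

/-- The prefix of `a` of length `j`, with its last digit decreased by one. -/
def decPrefix (a : ℕ → ℕ) (j : ℕ) : ℕ → ℕ := fun i => if i + 1 = j then a i - 1 else a i

/-- No nonempty suffix of the prefix of `a` of length `j` is a prefix of the reflection of `a`. -/
def Escaping (M : ℕ) (a : ℕ → ℕ) (j : ℕ) : Prop :=
  1 ≤ j ∧ ∀ s < j, ∃ i < j - s, a (s + i) + a i ≠ M

theorem Escaping.loGT {M : ℕ} {a : ℕ → ℕ} {j s : ℕ} (ha : Admissible M a a)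
    (hj : Escaping M a j) (hs : s < j) : LoGT M a a s (j - s) := by
  rcases loGT_or_eq ha s (j - s) with h | h
  · exact h
  · obtain ⟨i, hi, hne⟩ := hj.2 s hs
    exact absurd (h i hi) hne

theorem Escaping.lt_last {M : ℕ} {a : ℕ → ℕ} {j : ℕ} (ha : Admissible M a a)
    (hj : Escaping M a j) : M < a (j - 1) + a 0 := by
  have h1 := hj.1
  obtain ⟨m, hm, -, h⟩ := hj.loGT ha (s := j - 1) (by omega)
  obtain rfl : m = 0 := by omega
  exact h

theorem Escaping.last_pos {M : ℕ} {a : ℕ → ℕ} {j : ℕ} (ha : Admissible M a a)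
    (hj : Escaping M a j) : 0 < a (j - 1) := by
  have h1 := hj.lt_last ha
  have h2 := ha.1 0
  omega

theorem decPrefix_of_lt {a : ℕ → ℕ} {i j : ℕ} (h : i + 1 < j) : decPrefix a j i = a i := by
  simp [decPrefix, h.ne]

theorem decPrefix_last (a : ℕ → ℕ) (i : ℕ) : decPrefix a (i + 1) i = a i - 1 := by
  simp [decPrefix]

theorem decPrefix_le (a : ℕ → ℕ) (i j : ℕ) : decPrefix a j i ≤ a i := by
  unfold decPrefix
  split_ifs <;> omega

theorem Escaping.upLT_of_decPrefix {M : ℕ} {a x : ℕ → ℕ} {j t : ℕ} (ha : Admissible M a a)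
    (hj : Escaping M a j) (hx : ∀ i < j, x i = decPrefix a j i) (ht : t < j) :
    UpLT a x t (j - t) := by
  have hpos := hj.last_pos ha
  rcases upLT_or_eq ha t (j - t) with ⟨m, hm, h1, h2⟩ | h
  · refine ⟨m, hm, fun i hi => ?_, ?_⟩
    · rw [hx _ (by omega), decPrefix_of_lt (by omega), h1 i hi]
    · rw [hx _ (by omega)]
      exact (decPrefix_le _ _ _).trans_lt h2
  · refine ⟨j - t - 1, by omega, fun i hi => ?_, ?_⟩
    · rw [hx _ (by omega), decPrefix_of_lt (by omega), h i (by omega)]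
    · rw [hx _ (by omega), ← h (j - t - 1) (by omega), show t + (j - t - 1) = j - 1 by omega]
      unfold decPrefix
      split_ifs <;> omega

theorem Escaping.loGT_or_eq_of_decPrefix {M : ℕ} {a x : ℕ → ℕ} {j t : ℕ} (ha : Admissible M a a)
    (hj : Escaping M a j) (hx : ∀ i < j, x i = decPrefix a j i) (ht : t < j) :
    LoGT M a x t (j - t) ∨ ∀ i < j - t, x (t + i) + a i = M := by
  have hpos := hj.last_pos ha
  obtain ⟨m, hm, h1, h2⟩ := hj.loGT ha ht
  have hagree : ∀ i < m, x (t + i) + a i = M := fun i hi => by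
    rw [hx _ (by omega), decPrefix_of_lt (by omega), h1 i hi]
  rcases lt_or_ge M (x (t + m) + a m) with h | h
  · exact Or.inl ⟨m, hm, hagree, h⟩
  · right
    rw [hx _ (by omega)] at h
    have hlast : t + m + 1 = j := by
      by_contra hne
      rw [decPrefix_of_lt (by omega)] at h
      omega
    intro i hi
    rcases lt_or_ge i m with hi' | hi'
    · exact hagree i hi'
    · obtain rfl : i = m := by omega
      rw [hx _ (by omega)]
      unfold decPrefix at h ⊢
      rw [if_pos hlast] at h ⊢
      have : 0 < a (t + i) := by rwa [show t + i = j - 1 by omega]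
      omega

theorem Escaping.strictBalanced_join {M : ℕ} {a z : ℕ → ℕ} {j : ℕ} (ha : Admissible M a a)
    (hj : Escaping M a j) (hz : StrictBalanced M a z)
    (hc : ∀ s < j, (∀ i < j - s, decPrefix a j (s + i) + a i = M) →
      ∃ m, (∀ i < m, z i + a (j - s + i) = M) ∧ M < z m + a (j - s + m)) :
    StrictBalanced M a (joinSeq j (decPrefix a j) z) := by
  have hpre : ∀ i < j, joinSeq j (decPrefix a j) z i = decPrefix a j i :=
    fun i hi => joinSeq_of_lt _ _ hi
  refine ⟨fun i => ?_, fun t => ?_, ?_⟩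
  · unfold joinSeq
    split_ifs
    · exact (decPrefix_le _ _ _).trans (ha.1 i)
    · exact hz.1 _
  · rcases lt_or_ge t j with ht | ht
    · refine ⟨⟨_, hj.upLT_of_decPrefix ha hpre ht⟩, ?_⟩
      rcases hj.loGT_or_eq_of_decPrefix ha hpre ht with h | h
      · exact ⟨_, h⟩
      · obtain ⟨m, hm, hm'⟩ := hc t ht fun i hi => by rw [← hpre _ (by omega), h i hi]
        refine ⟨j - t + m + 1, j - t + m, by omega, fun i hi => ?_, ?_⟩
        · rcases lt_or_ge i (j - t) with hi' | hi'
          · exact h i hi'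
          · rw [joinSeq_of_le _ _ (by omega)]
            have := hm (i - (j - t)) (by omega)
            rwa [show j - t + (i - (j - t)) = i by omega,
              show i - (j - t) = t + i - j by omega] at this
        · rwa [show t + (j - t + m) = j + m by omega, joinSeq_add]
    · obtain ⟨⟨N, hN⟩, N', hN'⟩ := hz.2.1 (t - j)
      have hcongr : ∀ i, joinSeq j (decPrefix a j) z (t + i) = z (t - j + i) := fun i => by
        rw [joinSeq_of_le _ _ (by omega)]
        congr 1
        omega
      exact ⟨⟨N, hN.congr fun i _ => hcongr i⟩, ⟨N', hN'.congr fun i _ => hcongr i⟩⟩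
  · obtain ⟨K, hK⟩ := hz.2.2
    refine ⟨j + K, fun i hi => ?_⟩
    have := hK (i - j) (by omega)
    unfold BalancedAt at this ⊢
    rw [joinSeq_of_le _ _ (by omega), joinSeq_of_le _ _ (by omega)]
    rwa [show i + 1 - j = i - j + 1 by omega]

/-- Periodic repetition of the decreased prefix. -/
def decPer (a : ℕ → ℕ) (l : ℕ) : ℕ → ℕ := fun i => decPrefix a l (i % l)

/-- A combinatorial form of irreducibility, at the escaping index `l`. -/
def IrredAt (M : ℕ) (a : ℕ → ℕ) (l : ℕ) : Prop :=
  ∃ D, (∀ i < D, decPer a l i + a (l + i) = M) ∧ M < decPer a l D + a (l + D)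

theorem Escaping.exists_repeat {M : ℕ} {a x : ℕ → ℕ} {l : ℕ} (ha : Admissible M a a)
    (hl : Escaping M a l) (h0 : ¬ (l = 1 ∧ 2 * a 0 = M + 1)) (h0' : M < 2 * a 0)
    (hx : StrictBalanced M a x) (hxl : ∀ i < l, x i = decPrefix a l i) (N : ℕ) :
    ∃ z, StrictBalanced M a z ∧ ∀ i < (N + 1) * l, z i = decPer a l i := by
  have hl1 := hl.1
  induction N with
  | zero =>
    refine ⟨x, hx, fun i hi => ?_⟩
    rw [zero_add, one_mul] at hi
    rw [hxl i hi, decPer, Nat.mod_eq_of_lt hi]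
  | succ N ih =>
    obtain ⟨z, hz, hzl⟩ := ih
    refine ⟨joinSeq l (decPrefix a l) z, hl.strictBalanced_join ha hz ?_, fun i hi => ?_⟩
    · intro s hs hmatch
      have hs0 : 0 < s := by
        rcases Nat.eq_zero_or_pos s with rfl | h
        · exfalso
          have := hmatch 0 (by omega)
          simp only [add_zero, decPrefix, zero_add] at this
          split_ifs at this <;> omega
        · exact h
      obtain ⟨m, hm, h1, h2⟩ := hl.loGT ha (s := l - s) (by omega)
      have hza : ∀ i ≤ m, z i = a i := fun i hi => by
        have : l ≤ (N + 1) * l := Nat.le_mul_of_pos_left _ (by omega)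
        rw [hzl i (by omega), decPer, Nat.mod_eq_of_lt (by omega), decPrefix_of_lt (by omega)]
      refine ⟨m, fun i hi => ?_, ?_⟩
      · rw [hza i (by omega), add_comm, h1 i hi]
      · rwa [hza m le_rfl, add_comm]
    · rcases lt_or_ge i l with h | h
      · rw [joinSeq_of_lt _ _ h, decPer, Nat.mod_eq_of_lt h]
      · rw [Nat.succ_mul] at hi
        rw [joinSeq_of_le _ _ h, hzl _ (by omega), decPer, decPer, Nat.mod_eq_sub_mod h]

theorem Wide.lt_two_mul {M : ℕ} {a : ℕ → ℕ} (hw : Wide M a) : M < 2 * a 0 := by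
  unfold Wide at hw
  omega

theorem Escaping.exists_exit {M : ℕ} {a x : ℕ → ℕ} {l : ℕ} (ha : Admissible M a a)
    (hw : Wide M a) (hl : Escaping M a l)
    (hirr : ¬ (l = 1 ∧ 2 * a 0 = M + 1) → IrredAt M a l)
    (hx : StrictBalanced M a x) (hxl : ∀ i < l, x i = decPrefix a l i) :
    ∃ z, StrictBalanced M a z ∧ ∃ m, (∀ i < m, z i + a (l + i) = M) ∧ M < z m + a (l + m) := by
  by_cases h0 : l = 1 ∧ 2 * a 0 = M + 1
  · obtain ⟨rfl, h0⟩ := h0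
    refine ⟨_, (strictBalanced_of_balanced hw (balSeq_balanced M)).tail 1, 0,
      fun i hi => absurd hi (Nat.not_lt_zero i), ?_⟩
    unfold Wide at hw
    simp [balSeq]
    omega
  · obtain ⟨D, hD, hD'⟩ := hirr h0
    obtain ⟨z, hz, hzl⟩ := hl.exists_repeat ha h0 hw.lt_two_mul hx hxl D
    have hlt : ∀ i ≤ D, z i = decPer a l i := fun i hi => hzl i (by nlinarith [hl.1])
    exact ⟨z, hz, D, fun i hi => by rw [hlt i hi.le, hD i hi], by rwa [hlt D le_rfl]⟩

theorem Escaping.exists_strictBalanced {M : ℕ} {a : ℕ → ℕ} (ha : Admissible M a a)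
    (hw : Wide M a)
    (hirr : ∀ l, Escaping M a l → ¬ (l = 1 ∧ 2 * a 0 = M + 1) → IrredAt M a l) (j : ℕ)
    (hj : Escaping M a j) : ∃ x, StrictBalanced M a x ∧ ∀ i < j, x i = decPrefix a j i := by
  induction j using Nat.strong_induction_on with
  | _ j ih =>
  have hj1 := hj.1
  have hex : ∃ t, ∀ i < j - t, decPrefix a j (t + i) + a i = M :=
    ⟨j, fun i hi => by omega⟩
  obtain ⟨t, htm, hmin⟩ : ∃ t, (∀ i < j - t, decPrefix a j (t + i) + a i = M) ∧
      ∀ s < t, ¬ ∀ i < j - s, decPrefix a j (s + i) + a i = M :=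
    ⟨Nat.find hex, Nat.find_spec hex, fun s hs => Nat.find_min hex hs⟩
  have htj : t ≤ j := by
    by_contra hcon
    exact hmin j (by omega) fun i hi => by omega
  rcases Nat.eq_zero_or_pos t with rfl | ht0
  · have h := htm 0 (by omega)
    have h2 := hw.lt_two_mul
    unfold decPrefix at h
    simp only [zero_add] at h
    split_ifs at h with h1
    · refine ⟨_, strictBalanced_of_balanced hw (balSeq_balanced M), fun i hi => ?_⟩
      obtain rfl : i = 0 := by omega
      simp only [balSeq, decPrefix, zero_add, h1]
      simp
      omega
    · omega
  · obtain ⟨z, hz, m, hm, hm'⟩ : ∃ z, StrictBalanced M a z ∧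
        ∃ m, (∀ i < m, z i + a (j - t + i) = M) ∧ M < z m + a (j - t + m) := by
      rcases htj.eq_or_lt with rfl | htj
      · have hb := strictBalanced_of_balanced hw (balSeq_balanced M)
        obtain ⟨N, m, -, h1, h2⟩ := (hb.2.1 0).2
        exact ⟨_, hb, m, by simpa using h1, by simpa using h2⟩
      · have hesc : Escaping M a (j - t) := by
          refine ⟨by omega, fun s hs => ?_⟩
          by_contra hcon
          push Not at hcon
          obtain ⟨m, hm, h1, h2⟩ :=
            hj.upLT_of_decPrefix ha (x := decPrefix a j) (t := t + s) (fun _ _ => rfl) (by omega)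
          have e1 := htm (s + m) (by omega)
          have e2 := hcon m (by omega)
          rw [← add_assoc] at e1
          omega
        obtain ⟨x, hx, hxl⟩ := ih (j - t) (by omega) hesc
        exact hesc.exists_exit ha hw (hirr _ hesc) hx hxl
    refine ⟨_, hj.strictBalanced_join ha hz ?_, fun i hi => joinSeq_of_lt _ _ hi⟩
    intro s hs hmatch
    have hts : t ≤ s := by
      by_contra hcon
      exact hmin s (by omega) hmatch
    -- the prefix of length `j - s` is a suffix of the prefix of length `j - t`
    have hsub : ∀ i < j - s, a (s - t + i) = a i := fun i hi => by
      have e1 := hmatch i hi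
      have e2 := htm (s - t + i) (by omega)
      rw [show t + (s - t + i) = s + i by omega] at e2
      omega
    have hcomp : ∀ n, (∀ i < n, a (j - t + i) = a (j - s + i)) →
        a (j - t + n) ≤ a (j - s + n) := fun n hn => by
      have := ha.2.1 (s - t) (j - s + n) fun i hi => by
        rcases lt_or_ge i (j - s) with h | h
        · exact hsub i h
        · have := hn (i - (j - s)) (by omega)
          rwa [show j - t + (i - (j - s)) = s - t + i by omega,
            show j - s + (i - (j - s)) = i by omega] at this
      rwa [show s - t + (j - s + n) = j - t + n by omega] at this
    by_cases hall : ∀ i ≤ m, a (j - t + i) = a (j - s + i)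
    · exact ⟨m, fun i hi => by rw [← hall i hi.le, hm i hi], by rwa [← hall m le_rfl]⟩
    · push Not at hall
      obtain ⟨d, hd, hdm⟩ : ∃ d, (d ≤ m ∧ a (j - t + d) ≠ a (j - s + d)) ∧
          ∀ i < d, ¬ (i ≤ m ∧ a (j - t + i) ≠ a (j - s + i)) :=
        ⟨Nat.find hall, Nat.find_spec hall, fun i hi => Nat.find_min hall hi⟩
      have heq : ∀ i < d, a (j - t + i) = a (j - s + i) := fun i hi => by
        by_contra hne
        exact hdm i hi ⟨by omega, hne⟩
      have hle := hcomp d heq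
      refine ⟨d, fun i hi => by rw [← heq i hi, hm i (by omega)], ?_⟩
      rcases hd.1.lt_or_eq with h | rfl
      · have := hm d h
        omega
      · omega

/-- The suffix from `s` of the prefix of `a` of length `j` is a prefix of the reflection of `a`. -/
def ReflMatch (M : ℕ) (a : ℕ → ℕ) (s j : ℕ) : Prop := s < j ∧ ∀ i < j - s, a (s + i) + a i = M

theorem exists_reflMatch {M : ℕ} {a : ℕ → ℕ} {j : ℕ} (hj : 1 ≤ j) (h : ¬ Escaping M a j) :
    ∃ s, ReflMatch M a s j := by
  unfold Escaping at h
  push Not at h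
  obtain ⟨s, hs, h⟩ := h hj
  exact ⟨s, hs, h⟩

theorem ReflMatch.succ {M : ℕ} {a : ℕ → ℕ} {s s' j : ℕ} (ha : Admissible M a a)
    (h : ReflMatch M a s j) (h' : ReflMatch M a s' (j + 1)) (hs : s < s') :
    ReflMatch M a s (j + 1) := by
  obtain ⟨h1, h2⟩ := h
  obtain ⟨h1', h2'⟩ := h'
  refine ⟨by omega, fun i hi => ?_⟩
  rcases lt_or_ge i (j - s) with h | h
  · exact h2 i h
  · obtain rfl : i = j - s := by omega
    refine le_antisymm ?_ (ha.2.2 s (j - s) h2)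
    have hle := ha.2.1 (s' - s) (j - s') fun i hi => by
      have e1 := h2 (s' - s + i) (by omega)
      have e2 := h2' i (by omega)
      rw [show s + (s' - s + i) = s' + i by omega] at e1
      omega
    have e := h2' (j - s') (by omega)
    rw [show s' - s + (j - s') = j - s by omega] at hle
    rw [show s' + (j - s') = j by omega] at e
    rw [show s + (j - s) = j by omega]
    omega

theorem exists_escaping_gt {M : ℕ} {a : ℕ → ℕ} (ha : Admissible M a a) (hw : Wide M a)
    (hirr : ∀ l, Escaping M a l → ¬ (l = 1 ∧ 2 * a 0 = M + 1) → IrredAt M a l) (k : ℕ) :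
    ∃ j > k, Escaping M a j := by
  by_contra hcon
  push Not at hcon
  have hfull : ∃ s, ∀ i, a (s + i) + a i = M := by
    have hex := exists_reflMatch (by omega) (hcon (k + 1) (by omega))
    have hstable : ∀ n, ReflMatch M a (Nat.find hex) (k + 1 + n) ∧
        ∀ r < Nat.find hex, ¬ ReflMatch M a r (k + 1 + n) := by
      intro n
      induction n with
      | zero => exact ⟨Nat.find_spec hex, fun r hr => Nat.find_min hex hr⟩
      | succ n ih =>
        have hno : ∀ r < Nat.find hex, ¬ ReflMatch M a r (k + 1 + n + 1) := fun r hr h =>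
          ih.2 r hr ⟨hr.trans ih.1.1, fun i hi => h.2 i (by omega)⟩
        refine ⟨?_, hno⟩
        obtain ⟨s, hs⟩ := exists_reflMatch (by omega) (hcon (k + 1 + n + 1) (by omega))
        rcases lt_trichotomy s (Nat.find hex) with h | h | h
        · exact absurd hs (hno s h)
        · rwa [h] at hs
        · exact ih.1.succ ha hs h
    refine ⟨Nat.find hex, fun i => (hstable (Nat.find hex + i)).1.2 i ?_⟩
    omega
  obtain ⟨s, hs, hmin⟩ : ∃ s, (∀ i, a (s + i) + a i = M) ∧
      ∀ r < s, ¬ ∀ i, a (r + i) + a i = M :=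
    ⟨Nat.find hfull, Nat.find_spec hfull, fun r hr => Nat.find_min hfull hr⟩
  have h2 := hw.lt_two_mul
  have hs0 : 0 < s := by
    rcases Nat.eq_zero_or_pos s with rfl | h
    · have := hs 0
      rw [add_zero] at this
      omega
    · exact h
  have hesc : Escaping M a s := by
    by_contra hne
    obtain ⟨r, hr⟩ := exists_reflMatch hs0 hne
    have hall : ∀ n, ReflMatch M a r (s + n) := by
      intro n
      induction n with
      | zero => exact hr
      | succ n ih => exact ih.succ ha ⟨Nat.lt_succ_of_le (Nat.le_add_right s n), fun i _ => hs i⟩ hr.1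
    exact hmin r hr.1 fun i => (hall (i + 1)).2 i (by have := hr.1; omega)
  by_cases hexc : s = 1 ∧ 2 * a 0 = M + 1
  · obtain ⟨rfl, h0⟩ := hexc
    have := hs 0
    rw [add_zero] at this
    unfold Wide at hw
    omega
  · obtain ⟨D, hD, hD'⟩ := hirr s hesc hexc
    have hlast : decPer a s (s - 1) + a (s + (s - 1)) < M := by
      have h1 := hs (s - 1)
      have h3 := hesc.last_pos ha
      unfold decPer decPrefix
      rw [Nat.mod_eq_of_lt (by omega), if_pos (by omega)]
      omega
    rcases lt_or_ge (s - 1) D with h | h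
    · exact hlast.ne (hD _ h)
    · rcases h.eq_or_lt with rfl | h
      · omega
      · unfold decPer at hD'
        rw [Nat.mod_eq_of_lt (by omega), decPrefix_of_lt (by omega)] at hD'
        have := hs D
        omega

theorem Escaping.decPer_admissible {M : ℕ} {a : ℕ → ℕ} {l : ℕ} (ha : Admissible M a a)
    (hl : Escaping M a l) (h0 : ¬ (l = 1 ∧ 2 * a 0 = M + 1)) (h0' : M < 2 * a 0) :
    Admissible M (decPer a l) (decPer a l) := by
  have hl1 := hl.1
  have hp : ∀ i < l, decPer a l i = decPrefix a l i := fun i hi => by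
    rw [decPer, Nat.mod_eq_of_lt hi]
  have hpa : ∀ i, i + 1 < l → decPer a l i = a i := fun i hi => by
    rw [hp i (by omega), decPrefix_of_lt hi]
  have hper : ∀ t i, decPer a l (t + i) = decPer a l (t % l + i) := fun t i => by
    simp [decPer]
  have hsig : memSigma M (decPer a l) := fun i => (decPrefix_le _ _ _).trans (ha.1 _)
  refine ⟨hsig, fun t m hm => ?_, fun t m hm => ?_⟩
  · have htl : t % l < l := Nat.mod_lt _ (by omega)
    rw [hper]
    simp only [hper t] at hm
    generalize t % l = t at *
    rcases Nat.eq_zero_or_pos t with rfl | ht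
    · rw [zero_add]
    · obtain ⟨n, hn, h1, h2⟩ := hl.upLT_of_decPrefix ha hp htl
      rw [← hpa n (by omega)] at h2
      rcases lt_trichotomy m n with h | rfl | h
      · rw [h1 m h, hpa m (by omega)]
      · exact h2.le
      · exact absurd (hm n h) h2.ne
  · have htl : t % l < l := Nat.mod_lt _ (by omega)
    rw [hper]
    simp only [hper t] at hm
    generalize t % l = t at *
    rcases Nat.eq_zero_or_pos t with rfl | ht
    · have hpos : M ≤ decPer a l 0 + decPer a l 0 ∧
          (M = decPer a l 0 + decPer a l 0 → l = 1) := by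
        rw [hp 0 (by omega)]
        unfold decPrefix
        split_ifs <;> omega
      rcases Nat.eq_zero_or_pos m with rfl | h
      · rw [zero_add]
        exact hpos.1
      · have e := hm 0 h
        rw [zero_add] at e
        obtain rfl := hpos.2 e.symm
        have : ∀ i, decPer a 1 i = decPer a 1 0 := fun i => by simp [decPer, Nat.mod_one]
        rw [this, this m]
        exact hpos.1
    · rcases hl.loGT_or_eq_of_decPrefix ha hp htl with ⟨n, hn, h1, h2⟩ | hfull
      · rw [← hpa n (by omega)] at h2
        rcases lt_trichotomy m n with h | rfl | h
        · rw [hpa m (by omega), h1 m h]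
        · exact h2.le
        · exact absurd (hm n h) h2.ne'
      · have hfull' : ∀ i < l - t, decPer a l (t + i) + decPer a l i = M := fun i hi => by
          rw [hpa i (by omega)]
          exact hfull i hi
        rcases hl.loGT_or_eq_of_decPrefix ha hp (t := l - t) (by omega) with
          ⟨n, hn, h1, h2⟩ | hfull2
        · rw [← hpa n (by omega)] at h2
          have hsh : ∀ i, decPer a l (t + (l - t + i)) = decPer a l i := fun i => by
            rw [show t + (l - t + i) = l + i by omega, hper, Nat.mod_self, zero_add]
          rcases lt_trichotomy m (l - t + n) with h | rfl | h
          · rcases lt_or_ge m (l - t) with h' | h'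
            · exact (hfull' m h').ge
            · obtain ⟨c, rfl⟩ := Nat.exists_eq_add_of_le h'
              rw [hsh, hpa c (by omega), add_comm, h1 c (by omega)]
          · rw [hsh]
            omega
          · have := hm _ h
            rw [hsh] at this
            omega
        · have hone : ∀ i < l, decPer a l (t + i) + decPer a l i = M := fun i hi => by
            rcases lt_or_ge i (l - t) with h | h
            · exact hfull' i h
            · have e := hfull2 (i - (l - t)) (by omega)
              rw [← hpa _ (by omega), show l - t + (i - (l - t)) = i by omega] at e
              rw [show t + i = l + (i - (l - t)) by omega, hper, Nat.mod_self, zero_add, add_comm]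
              exact e
          have e := hone (m % l) (Nat.mod_lt _ (by omega))
          have e1 : decPer a l (t + m) = decPer a l (t + m % l) := by simp [decPer]
          have e2 : decPer a l m = decPer a l (m % l) := by simp [decPer]
          rw [e1, e2, e]

theorem prefixWord_succ (a : ℕ → ℕ) (n : ℕ) : prefixWord a (n + 1) = prefixWord a n ++ [a n] := by
  simp [prefixWord, List.range_succ]

theorem length_prefixWord (a : ℕ → ℕ) (n : ℕ) : (prefixWord a n).length = n := by
  simp [prefixWord]

theorem getD_prefixWord {a : ℕ → ℕ} {i n : ℕ} (h : i < n) : (prefixWord a n).getD i 0 = a i := by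
  simp [prefixWord, List.getD_eq_getElem?_getD, h]

theorem prefixWord_congr {a b : ℕ → ℕ} {n : ℕ} (h : ∀ i < n, a i = b i) :
    prefixWord a n = prefixWord b n :=
  List.map_congr_left fun i hi => h i (List.mem_range.1 hi)

theorem wMinus_prefixWord (a : ℕ → ℕ) (n : ℕ) :
    wMinus (prefixWord a (n + 1)) = prefixWord (decPrefix a (n + 1)) (n + 1) := by
  rw [prefixWord_succ, prefixWord_succ, decPrefix_last,
    prefixWord_congr fun i hi => decPrefix_of_lt (a := a) (show i + 1 < n + 1 by omega)]
  simp [wMinus, List.getLast!_eq_getLast?_getD]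

theorem wPlus_wRefl_prefixWord {M : ℕ} {a : ℕ → ℕ} {n : ℕ} (ha : memSigma M a) (h : 0 < a n) :
    wPlus (wRefl M (prefixWord a (n + 1))) =
      prefixWord (reflSeq M (decPrefix a (n + 1))) (n + 1) := by
  have e : wRefl M (prefixWord a (n + 1)) = prefixWord (reflSeq M a) n ++ [M - a n] := by
    rw [prefixWord_succ]
    simp [wRefl, prefixWord, reflSeq]
  have e2 : prefixWord (reflSeq M (decPrefix a (n + 1))) n = prefixWord (reflSeq M a) n :=
    prefixWord_congr fun i hi => by
      rw [reflSeq, reflSeq, decPrefix_of_lt (show i + 1 < n + 1 by omega)]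
  rw [e, prefixWord_succ, e2]
  have := ha n
  simp only [reflSeq, decPrefix_last]
  rw [show M - (a n - 1) = M - a n + 1 by omega]
  simp [wPlus, List.getLast!_eq_getLast?_getD]

theorem perSeq_prefixWord (a : ℕ → ℕ) {n : ℕ} (hn : 0 < n) :
    perSeq (prefixWord a n) = fun i => a (i % n) := by
  funext i
  rw [perSeq, length_prefixWord, getD_prefixWord (Nat.mod_lt _ hn)]

theorem IrreducibleSeq.irredAt {M : ℕ} {a : ℕ → ℕ} {l : ℕ} (ha : Admissible M a a)
    (hirr : IrreducibleSeq M a) (hl : Escaping M a l) (h0 : ¬ (l = 1 ∧ 2 * a 0 = M + 1))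
    (h0' : M < 2 * a 0) : IrredAt M a l := by
  have hpos := hl.last_pos ha
  have hadm := hl.decPer_admissible ha h0 h0'
  have hl1 := hl.1
  obtain ⟨n, rfl⟩ : ∃ n, l = n + 1 := ⟨l - 1, by omega⟩
  rw [Nat.add_sub_cancel] at hpos
  have hV := hirr (n + 1) hl1
  rw [wMinus_prefixWord, wPlus_wRefl_prefixWord ha.1 hpos, perSeq_prefixWord _ (by omega)] at hV
  obtain ⟨d, hd, hd'⟩ := hV ((admissible_iff hadm.1 _).1 hadm)
  have hlow : ∀ i < n + 1, wordThenPer (prefixWord a (n + 1))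
      (prefixWord (reflSeq M (decPrefix a (n + 1))) (n + 1)) i = a i := fun i hi => by
    rw [wordThenPer, length_prefixWord, if_pos hi, getD_prefixWord hi]
  have hhigh : ∀ i, wordThenPer (prefixWord a (n + 1))
      (prefixWord (reflSeq M (decPrefix a (n + 1))) (n + 1)) (n + 1 + i) =
        M - decPer a (n + 1) i := fun i => by
    rw [wordThenPer, length_prefixWord, if_neg (by omega), perSeq_prefixWord _ (by omega)]
    simp only [Nat.add_sub_cancel_left, reflSeq, decPer]
  have hdn : n + 1 ≤ d := by
    by_contra hcon
    rw [hlow d (by omega)] at hd'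
    exact lt_irrefl _ hd'
  obtain ⟨D, rfl⟩ := Nat.exists_eq_add_of_le hdn
  rw [hhigh] at hd'
  refine ⟨D, fun i hi => ?_, by omega⟩
  have e := hd (n + 1 + i) (by omega)
  rw [hhigh] at e
  have := hadm.1 i
  omega

theorem Admissible.refl {M : ℕ} {a x : ℕ → ℕ} (ha : memSigma M a) (hx : Admissible M a x) :
    Admissible M a (reflSeq M x) := by
  obtain ⟨h0, h1, h2⟩ := hx
  refine ⟨fun i => Nat.sub_le _ _, fun t m hm => ?_, fun t m hm => ?_⟩
  · have := h2 t m fun i hi => by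
      have := hm i hi
      have := h0 (t + i)
      simp only [reflSeq] at *
      omega
    simp only [reflSeq]
    omega
  · have := h1 t m fun i hi => by
      have := hm i hi
      have := h0 (t + i)
      have := ha i
      simp only [reflSeq] at *
      omega
    have := h0 (t + m)
    simp only [reflSeq]
    omega

theorem exists_strictBalanced_agree_of_match {M : ℕ} {a x : ℕ → ℕ} (ha : Admissible M a a)
    (hw : Wide M a)
    (hirr : ∀ l, Escaping M a l → ¬ (l = 1 ∧ 2 * a 0 = M + 1) → IrredAt M a l)
    (hx : Admissible M a x) {N t : ℕ} (ht : t ≤ N) (hm : ∀ i < N - t, x (t + i) = a i)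
    (hup : ∀ s < t, ¬ ∀ i < N - s, x (s + i) = a i)
    (hlo : ∀ s < t, ¬ ∀ i < N - s, x (s + i) + a i = M) :
    ∃ y, StrictBalanced M a y ∧ ∀ i < N, y i = x i := by
  obtain ⟨j, hj, hesc⟩ := exists_escaping_gt ha hw hirr (N - t)
  obtain ⟨z, hz, hzj⟩ := hesc.exists_strictBalanced ha hw hirr
  have hagree : ∀ i < N, joinSeq t x z i = x i := fun i hi => by
    rcases lt_or_ge i t with h | h
    · exact joinSeq_of_lt _ _ h
    · rw [joinSeq_of_le _ _ h, hzj _ (by omega), decPrefix_of_lt (by omega),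
        ← hm _ (by omega)]
      congr 1
      omega
  refine ⟨joinSeq t x z, ⟨fun i => ?_, fun s => ?_, ?_⟩, hagree⟩
  · unfold joinSeq
    split_ifs
    · exact hx.1 i
    · exact hz.1 _
  · rcases lt_or_ge s t with h | h
    · have hcongr : ∀ i < N - s, joinSeq t x z (s + i) = x (s + i) :=
        fun i hi => hagree _ (by omega)
      exact ⟨⟨_, ((upLT_or_eq hx s (N - s)).resolve_right (hup s h)).congr hcongr⟩,
        ⟨_, ((loGT_or_eq hx s (N - s)).resolve_right (hlo s h)).congr hcongr⟩⟩
    · obtain ⟨⟨n, hn⟩, n', hn'⟩ := hz.2.1 (s - t)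
      have hcongr : ∀ i, joinSeq t x z (s + i) = z (s - t + i) := fun i => by
        rw [joinSeq_of_le _ _ (by omega)]
        congr 1
        omega
      exact ⟨⟨n, hn.congr fun i _ => hcongr i⟩, ⟨n', hn'.congr fun i _ => hcongr i⟩⟩
  · obtain ⟨K, hK⟩ := hz.2.2
    refine ⟨t + K, fun i hi => ?_⟩
    have := hK (i - t) (by omega)
    unfold BalancedAt at this ⊢
    rw [joinSeq_of_le _ _ (by omega), joinSeq_of_le _ _ (by omega)]
    rwa [show i + 1 - t = i - t + 1 by omega]

theorem exists_strictBalanced_agree {M : ℕ} {a x : ℕ → ℕ} (ha : Admissible M a a)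
    (hw : Wide M a)
    (hirr : ∀ l, Escaping M a l → ¬ (l = 1 ∧ 2 * a 0 = M + 1) → IrredAt M a l)
    (hx : Admissible M a x) (N : ℕ) : ∃ y, StrictBalanced M a y ∧ ∀ i < N, y i = x i := by
  have hex : ∃ t, (∀ i < N - t, x (t + i) = a i) ∨ ∀ i < N - t, x (t + i) + a i = M :=
    ⟨N, Or.inl fun i hi => by omega⟩
  obtain ⟨t, ht, hmin⟩ : ∃ t, ((∀ i < N - t, x (t + i) = a i) ∨
      ∀ i < N - t, x (t + i) + a i = M) ∧ ∀ s < t, ¬ ((∀ i < N - s, x (s + i) = a i) ∨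
        ∀ i < N - s, x (s + i) + a i = M) :=
    ⟨Nat.find hex, Nat.find_spec hex, fun s hs => Nat.find_min hex hs⟩
  have htN : t ≤ N := by
    by_contra hcon
    exact hmin N (by omega) (Or.inl fun i hi => by omega)
  have hup : ∀ s < t, ¬ ∀ i < N - s, x (s + i) = a i := fun s hs h => hmin s hs (Or.inl h)
  have hlo : ∀ s < t, ¬ ∀ i < N - s, x (s + i) + a i = M := fun s hs h => hmin s hs (Or.inr h)
  rcases ht with ht | ht
  · exact exists_strictBalanced_agree_of_match ha hw hirr hx htN ht hup hlo
  · obtain ⟨y, hy, hyx⟩ := exists_strictBalanced_agree_of_match ha hw hirr (hx.refl ha.1) htN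
      (fun i hi => by
        have := ht i hi
        simp only [reflSeq]
        omega)
      (fun s hs h => hlo s hs fun i hi => by
        have := h i hi
        have := hx.1 (s + i)
        simp only [reflSeq] at *
        omega)
      (fun s hs h => hup s hs fun i hi => by
        have := h i hi
        have := hx.1 (s + i)
        simp only [reflSeq] at *
        omega)
    refine ⟨_, hy.refl ha.1, fun i hi => ?_⟩
    have := hyx i hi
    have := hx.1 i
    simp only [reflSeq] at *
    omega

/-- The strict balanced sequences whose strictness is visible on windows of length `n + 2`. -/
def windowBalanced (M : ℕ) (a : ℕ → ℕ) (n : ℕ) : Set (ℕ → ℕ) :=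
  {x | memSigma M x ∧ (∀ t, UpLT a x t (n + 2) ∧ LoGT M a x t (n + 2)) ∧
    ∃ K, ∀ i ≥ K, BalancedAt M x i}

theorem StrictBalanced.mem_windowBalanced {M : ℕ} {a x : ℕ → ℕ} (hw : Wide M a)
    (hx : StrictBalanced M a x) : ∃ n, x ∈ windowBalanced M a n := by
  obtain ⟨h0, h1, K, hK⟩ := hx
  choose f hf using fun t => (h1 t).1
  choose g hg using fun t => (h1 t).2
  refine ⟨∑ t ∈ Finset.range K, (f t + g t), h0, fun t => ?_, K, hK⟩
  rcases lt_or_ge t K with h | h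
  · have := Finset.single_le_sum (f := fun t => f t + g t) (fun _ _ => Nat.zero_le _)
      (Finset.mem_range.2 h)
    exact ⟨(hf t).mono (by omega), (hg t).mono (by omega)⟩
  · exact ⟨((hK t h).upLT hw).mono (by omega), ((hK t h).loGT hw).mono (by omega)⟩

theorem mem_windowBalanced_of_shift {M : ℕ} {a x : ℕ → ℕ} {n : ℕ}
    (hx : shift x ∈ windowBalanced M a n) (h0 : x 0 ≤ M) (hup : UpLT a x 0 (n + 2))
    (hlo : LoGT M a x 0 (n + 2)) : x ∈ windowBalanced M a n := by
  obtain ⟨hs, h1, K, hK⟩ := hx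
  refine ⟨fun i => ?_, fun t => ?_, K + 1, fun i hi => ?_⟩
  · cases i with
    | zero => exact h0
    | succ i => exact hs i
  · cases t with
    | zero => exact ⟨hup, hlo⟩
    | succ t =>
      have hcongr : ∀ i, x (t + 1 + i) = shift x (t + i) := fun i => by
        rw [shift]
        congr 1
        omega
      exact ⟨(h1 t).1.congr fun i _ => hcongr i, (h1 t).2.congr fun i _ => hcongr i⟩
  · have := hK (i - 1) (by omega)
    simp only [BalancedAt, shift] at this ⊢
    rwa [Nat.sub_add_cancel (by omega)] at this

theorem shift_mem_windowBalanced {M : ℕ} {a x : ℕ → ℕ} {n : ℕ}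
    (hx : x ∈ windowBalanced M a n) : shift x ∈ windowBalanced M a n := by
  obtain ⟨hs, h1, K, hK⟩ := hx
  refine ⟨fun i => hs _, fun t => ?_, K, fun i hi => hK (i + 1) (by omega)⟩
  have hcongr : ∀ i, shift x (t + i) = x (t + 1 + i) := fun i => by
    rw [shift]
    congr 1
    omega
  exact ⟨(h1 (t + 1)).1.congr fun i _ => hcongr i, (h1 (t + 1)).2.congr fun i _ => hcongr i⟩

theorem balPrepend_mem_windowBalanced {M : ℕ} {a x : ℕ → ℕ} {n : ℕ} (hw : Wide M a)
    (hx : x ∈ windowBalanced M a n) : balPrepend M x ∈ windowBalanced M a n := by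
  have e0 : balPrepend M x 0 = if M - M / 2 ≤ x 0 then M / 2 else M - M / 2 := rfl
  have e1 : balPrepend M x 1 = x 0 := rfl
  unfold Wide at hw
  refine mem_windowBalanced_of_shift hx ?_ ?_ ?_
  · rw [e0]
    split_ifs <;> omega
  · by_cases h : balPrepend M x 0 < a 0
    · exact ⟨0, by omega, fun i hi => absurd hi (Nat.not_lt_zero i), h⟩
    · refine ⟨1, by omega, fun i hi => ?_, ?_⟩
      · obtain rfl : i = 0 := by omega
        rw [e0] at h
        rw [add_zero, e0]
        split_ifs at h ⊢ <;> omega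
      · rw [zero_add, e1]
        rw [e0] at h
        split_ifs at h <;> omega
  · by_cases h : M < balPrepend M x 0 + a 0
    · exact ⟨0, by omega, fun i hi => absurd hi (Nat.not_lt_zero i), h⟩
    · refine ⟨1, by omega, fun i hi => ?_, ?_⟩
      · obtain rfl : i = 0 := by omega
        rw [e0] at h
        rw [add_zero, e0]
        split_ifs at h ⊢ <;> omega
      · rw [zero_add, e1]
        rw [e0] at h
        split_ifs at h <;> omega

theorem windowBalanced_admissible {M : ℕ} {a x : ℕ → ℕ} {n : ℕ}
    (hx : x ∈ windowBalanced M a n) : Admissible M a x := by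
  refine ⟨hx.1, fun t m hm => ?_, fun t m hm => ?_⟩
  · obtain ⟨d, -, h1, h2⟩ := (hx.2.1 t).1
    rcases lt_trichotomy m d with h | rfl | h
    · exact (h1 m h).le
    · exact h2.le
    · exact absurd (hm d h) h2.ne
  · obtain ⟨d, -, h1, h2⟩ := (hx.2.1 t).2
    rcases lt_trichotomy m d with h | rfl | h
    · exact (h1 m h).ge
    · exact h2.le
    · exact absurd (hm d h) h2.ne'

theorem isCoded_of_wide {M : ℕ} {a : ℕ → ℕ} (ha : Admissible M a a) (hw : Wide M a)
    (hirr : ∀ l, Escaping M a l → ¬ (l = 1 ∧ 2 * a 0 = M + 1) → IrredAt M a l) :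
    IsCoded M {x | Admissible M a x} := by
  have hEq : {x | Admissible M a x} = closure (⋃ n, windowBalanced M a n) := by
    apply Set.Subset.antisymm
    · intro x hx
      rw [mem_closure_iff_forall_agree]
      intro N
      obtain ⟨y, hy, hyx⟩ := exists_strictBalanced_agree ha hw hirr hx N
      exact ⟨y, Set.mem_iUnion.2 (hy.mem_windowBalanced hw), hyx⟩
    · intro x hx
      refine closure_subset_admissible (fun y hy => ?_) hx
      obtain ⟨n, hn⟩ := Set.mem_iUnion.1 hy
      exact windowBalanced_admissible hn
  rw [hEq]
  refine isCoded_closure_iUnion ?_ (fun n x hx => hx.1) (fun n x hx => shift_mem_windowBalanced hx)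
    (fun n x hx => hx.2.2) (fun n x hx => balPrepend_mem_windowBalanced hw hx) ?_
  · exact fun n x hx => ⟨hx.1, fun t => ⟨(hx.2.1 t).1.mono (by omega),
      (hx.2.1 t).2.mono (by omega)⟩, hx.2.2⟩
  · rintro n x hx ⟨y, hy, hyx⟩
    refine mem_windowBalanced_of_shift hx ?_ ((hy.2.1 0).1.congr fun i hi => ?_)
      ((hy.2.1 0).2.congr fun i hi => ?_)
    · rw [← hyx 0 (by omega)]
      exact hy.1 0
    all_goals rw [zero_add, hyx i hi]

theorem isCoded_balanced (M : ℕ) : IsCoded M {x | ∀ i, BalancedAt M x i} := by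
  have hcoded : IsCoded M (closure (⋃ _ : ℕ, {x | ∀ i, BalancedAt M x i})) := by
    refine isCoded_closure_iUnion (fun n => subset_rfl) (fun n x hx => memSigma_of_balanced hx)
      (fun n x hx i => hx (i + 1)) (fun n x hx => ⟨0, fun i _ => hx i⟩) ?_ ?_
    · intro n x hx i
      cases i with
      | zero =>
        have h := hx 0
        simp only [BalancedAt, balPrepend, zero_add] at h ⊢
        split_ifs <;> omega
      | succ i => exact hx i
    · rintro n x hx ⟨y, hy, hyx⟩ i
      cases i with
      | zero =>
        have h := hy 0
        unfold BalancedAt at h ⊢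
        rwa [hyx 0 (by omega), hyx (0 + 1) (by omega)] at h
      | succ i => exact hx i
  have hclosed : closure (⋃ _ : ℕ, {x | ∀ i, BalancedAt M x i}) =
      {x | ∀ i, BalancedAt M x i} := by
    rw [Set.iUnion_const]
    refine Set.Subset.antisymm (fun x hx i => ?_) subset_closure
    obtain ⟨y, hy, hyx⟩ := (mem_closure_iff_forall_agree _ _).1 hx (i + 2)
    have h := hy i
    unfold BalancedAt at h ⊢
    rwa [hyx i (by omega), hyx (i + 1) (by omega)] at h
  rwa [hclosed] at hcoded

theorem admissible_iff_balanced {M : ℕ} {a : ℕ → ℕ} (ha : Admissible M a a)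
    (hw : ¬ Wide M a) (x : ℕ → ℕ) : Admissible M a x ↔ ∀ i, BalancedAt M x i := by
  have ha0 : M ≤ a 0 + a 0 := by
    simpa using ha.2.2 0 0 fun i hi => absurd hi (Nat.not_lt_zero i)
  have hle : ∀ y, Admissible M a y → ∀ t, y t ≤ a 0 ∧ M ≤ y t + a 0 := fun y hy t =>
    ⟨hy.2.1 t 0 fun i hi => absurd hi (Nat.not_lt_zero i),
      hy.2.2 t 0 fun i hi => absurd hi (Nat.not_lt_zero i)⟩
  have ha1 := (hle a ha 1)
  unfold Wide at hw
  have hbal : ∀ y, Admissible M a y → ∀ i, BalancedAt M y i := by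
    intro y hy i
    have h1 := hle y hy i
    have h2 := hle y hy (i + 1)
    have hU := hy.2.1 i 1
    have hL := hy.2.2 i 1
    have hU' : y i = a 0 → y (i + 1) ≤ a 1 := fun h => hU fun c hc => by
      obtain rfl : c = 0 := by omega
      exact h
    have hL' : y i + a 0 = M → M ≤ y (i + 1) + a 1 := fun h => hL fun c hc => by
      obtain rfl : c = 0 := by omega
      exact h
    unfold BalancedAt
    omega
  refine ⟨hbal x, fun hx => ⟨memSigma_of_balanced hx, fun t m hm => ?_, fun t m hm => ?_⟩⟩
  · cases m with
    | zero =>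
      have := hx t
      unfold BalancedAt at this
      rw [add_zero]
      omega
    | succ m =>
      have h1 := hm m (by omega)
      have h2 := hx (t + m)
      have h3 := hbal a ha m
      unfold BalancedAt at h2 h3
      rw [← add_assoc]
      omega
  · cases m with
    | zero =>
      have := hx t
      unfold BalancedAt at this
      rw [add_zero]
      omega
    | succ m =>
      have h1 := hm m (by omega)
      have h2 := hx (t + m)
      have h3 := hbal a ha m
      unfold BalancedAt at h2 h3
      rw [← add_assoc]
      omega

/-- For every `q ∈ I`, the symmetric `q`-shift is a coded system. -/
theorem Vq_isCoded_of_irreducible (M : ℕ) (hM : 1 ≤ M) (q : ℝ) (hq : memI M q) :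
    IsCoded M (Vq M q) := by
  obtain ⟨⟨-, -, hV⟩, hirr⟩ := hq
  have ha : Admissible M (qg M q) (qg M q) := (admissible_iff hV.1 _).2 hV
  have hVq : Vq M q = {x | Admissible M (qg M q) x} :=
    Set.ext fun x => (admissible_iff hV.1 x).symm
  rw [hVq]
  by_cases hw : Wide M (qg M q)
  · exact isCoded_of_wide ha hw fun l hl h0 => hirr.irredAt ha hl h0 hw.lt_two_mul
  · simp only [admissible_iff_balanced ha hw]
    exact isCoded_balanced M
end

section
/- Let q ∈ V_L be such that α(q) is an irreducible sequence and the orbit {σ^n(α(q)) : n ≥ 0} is not dense in V_q. Then L(V_q) contains an intrinsically synchronising word; moreover, every word ω ∈ L(V_q) that is a factor of neither α(q) nor ᾱ(q) is intrinsically synchronising. -/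
open Classical

theorem shift_iterate_apply (x : ℕ → ℕ) (n i : ℕ) : shift^[n] x i = x (n + i) := by
  induction n generalizing x with
  | zero => simp
  | succ n ih =>
    rw [Function.iterate_succ_apply, ih]
    exact congrArg x (by omega)

theorem lexLT.trans_lexLE {x y z : ℕ → ℕ} (hxy : lexLT x y) (hyz : lexLE y z) : lexLT x z := by
  rcases hyz with rfl | ⟨m, hm, hm'⟩
  · exact hxy
  · obtain ⟨n, hn, hn'⟩ := hxy
    rcases lt_trichotomy n m with h | rfl | h
    · exact ⟨n, fun i hi => (hn i hi).trans (hm i (hi.trans h)), hm n h ▸ hn'⟩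
    · exact ⟨n, fun i hi => (hn i hi).trans (hm i hi), hn'.trans hm'⟩
    · exact ⟨m, fun i hi => (hn i (hi.trans h)).trans (hm i hi), (hn m h).symm ▸ hm'⟩

/-- If `x ≼ a` is decided within the first `N` letters, then it persists for every sequence
sharing these letters with `x`. -/
theorem lexLE.congr_left {x z a : ℕ → ℕ} {N : ℕ} (hx : lexLE x a) (hz : ∀ t < N, z t = x t)
    (hne : ¬ ∀ t < N, x t = a t) : lexLE z a := by
  rcases hx with rfl | ⟨p, hp, hp'⟩
  · exact absurd (fun _ _ => rfl) hne
  · have hpN : p < N := by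
      by_contra! h
      exact hne fun t ht => hp t (ht.trans_le h)
    exact Or.inr ⟨p, fun t ht => (hz t (ht.trans hpN)).trans (hp t ht), (hz p hpN).symm ▸ hp'⟩

/-- If `a ≼ x` is decided within the first `N` letters, then it persists for every sequence
sharing these letters with `x`. -/
theorem lexLE.congr_right {x z a : ℕ → ℕ} {N : ℕ} (hx : lexLE a x) (hz : ∀ t < N, z t = x t)
    (hne : ¬ ∀ t < N, x t = a t) : lexLE a z := by
  rcases hx with rfl | ⟨p, hp, hp'⟩
  · exact absurd (fun _ _ => rfl) hne
  · have hpN : p < N := by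
      by_contra! h
      exact hne fun t ht => (hp t (ht.trans_le h)).symm
    exact Or.inr ⟨p, fun t ht => (hp t ht).trans (hz t (ht.trans hpN)).symm,
      (hz p hpN).symm ▸ hp'⟩

theorem lexLE.reflSeq {M : ℕ} {x y : ℕ → ℕ} (h : lexLE x y) (hy : memSigma M y) :
    lexLE (reflSeq M y) (reflSeq M x) := by
  rcases h with rfl | ⟨n, hn, hn'⟩
  · exact Or.inl rfl
  · refine Or.inr ⟨n, fun i hi => by simp [_root_.reflSeq, hn i hi], ?_⟩
    have := hy n
    simp only [_root_.reflSeq]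
    omega

/-- The set of sequences all of whose shifts lie between the reflection of `a` and `a`. -/
def symShift (M : ℕ) (a : ℕ → ℕ) : Set (ℕ → ℕ) :=
  {x | memSigma M x ∧
    ∀ n : ℕ, lexLE (reflSeq M a) (shift^[n] x) ∧ lexLE (shift^[n] x) a}

theorem reflSeq_mem_symShift {M : ℕ} {a : ℕ → ℕ} (ha : memV M a) :
    reflSeq M a ∈ symShift M a := by
  have hcomm : ∀ n, shift^[n] (reflSeq M a) = reflSeq M (shift^[n] a) := fun n => by
    funext i
    simp [shift_iterate_apply, reflSeq]
  have hinv : reflSeq M (reflSeq M a) = a := by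
    funext i
    have := ha.1 i
    simp only [reflSeq]
    omega
  refine ⟨fun i => Nat.sub_le _ _, fun n => ?_⟩
  rw [hcomm]
  refine ⟨(ha.2 n).2.reflSeq ha.1, ?_⟩
  have h := (ha.2 n).1.reflSeq (M := M) fun i => by
    rw [shift_iterate_apply]
    exact ha.1 _
  rwa [hinv] at h

theorem intrinsicallySynchronising_of_not_isFactorOf {M : ℕ} {a : ℕ → ℕ} {w : List ℕ}
    (hw : ¬ IsFactorOf w a) (hw' : ¬ IsFactorOf w (reflSeq M a)) :
    IntrinsicallySynchronising (symShift M a) w := by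
  rintro u v ⟨x, hx, k, hk⟩ ⟨y, hy, l, hl⟩
  let z : ℕ → ℕ := fun t => if t < u.length then u.getD t 0 else y (l + (t - u.length))
  have hzx : ∀ t < u.length + w.length, z t = x (k + t) := by
    intro t ht
    rw [hk t (by simpa using ht)]
    by_cases htu : t < u.length
    · rw [List.getD_append _ _ _ _ htu]
      exact if_pos htu
    · have h1 := hl (t - u.length) (by simp; omega)
      rw [List.getD_append _ _ _ _ (by omega)] at h1
      simp only [z, htu, if_false, h1]
      rw [List.getD_append_right _ _ _ _ (by omega)]
  have hwx : ∀ s ≤ u.length, ∀ b : ℕ → ℕ, ¬ IsFactorOf w b →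
      ¬ ∀ t < u.length + w.length - s, shift^[k + s] x t = b t := by
    intro s hs b hb h
    refine hb ⟨u.length - s, fun t ht => ?_⟩
    rw [← h _ (by omega), shift_iterate_apply,
      show k + s + (u.length - s + t) = k + (u.length + t) by omega,
      hk _ (by simp; omega), List.getD_append_right _ _ _ _ (by omega)]
    congr 1
    omega
  refine ⟨z, ⟨fun t => ?_, fun s => ?_⟩, 0, fun t ht => ?_⟩
  · by_cases ht : t < u.length + w.length
    · exact hzx t ht ▸ hx.1 _
    · simp only [z, show ¬ t < u.length by omega, if_false]
      exact hy.1 _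
  · by_cases hs : s < u.length
    · have hzs : ∀ t < u.length + w.length - s, shift^[s] z t = shift^[k + s] x t := by
        intro t ht
        rw [shift_iterate_apply, shift_iterate_apply, hzx _ (by omega), add_assoc]
      exact ⟨(hx.2 (k + s)).1.congr_right hzs (hwx s hs.le _ hw'),
        (hx.2 (k + s)).2.congr_left hzs (hwx s hs.le _ hw)⟩
    · have hzs : shift^[s] z = shift^[l + (s - u.length)] y := by
        funext t
        rw [shift_iterate_apply, shift_iterate_apply]
        simp only [z, show ¬ s + t < u.length by omega, if_false]
        congr 1
        omega
      rw [hzs]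
      exact hy.2 _
  · rw [List.append_assoc, zero_add]
    simp only [List.length_append] at ht
    by_cases htu : t < u.length
    · rw [List.getD_append _ _ _ _ htu]
      exact if_pos htu
    · simp only [z, htu, if_false]
      rw [hl _ (by simp; omega), List.getD_append_right u _ _ _ (by omega)]

theorem mem_closure_orbit {a y : ℕ → ℕ} (h : ∀ N, ∃ k, ∀ i < N, a (k + i) = y i) :
    y ∈ closure (orbit a) := by
  choose k hk using h
  refine mem_closure_of_tendsto (f := fun N => shift^[k N] a) (b := Filter.atTop) ?_
    (Filter.Eventually.of_forall fun N => ⟨k N, rfl⟩)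
  refine tendsto_pi_nhds.2 fun i => tendsto_const_nhds.congr' ?_
  filter_upwards [Filter.eventually_gt_atTop i] with N hN
  rw [shift_iterate_apply, hk N i hN]

/-- The reflected prefix of `a` of length `n` occurs in `a` at position `i`. -/
def ReflPrefixAt (M : ℕ) (a : ℕ → ℕ) (n i : ℕ) : Prop := ∀ t < n, a (i + t) = M - a t

theorem lt_of_reflPrefixAt {M m i : ℕ} {a : ℕ → ℕ} (ha : memV M a)
    (hi : ReflPrefixAt M a m i) (hm : ¬ ReflPrefixAt M a (m + 1) i) :
    M - a m < a (i + m) := by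
  rcases (ha.2 i).1 with h | ⟨p, hp, hp'⟩
  · refine absurd (fun t _ => ?_) hm
    rw [← shift_iterate_apply a, ← h, reflSeq]
  · simp only [shift_iterate_apply, reflSeq] at hp hp'
    rcases lt_trichotomy p m with h | rfl | h
    · have := hi p h
      omega
    · exact hp'
    · exact absurd (fun t ht => (hp t (by omega)).symm) hm

/-- A prefix of `a` can be followed by the reflection of `a` at each occurrence of a maximal
reflected prefix. -/
theorem prefix_append_reflSeq_mem {M m i : ℕ} {a : ℕ → ℕ} (ha : memV M a)
    (hm : ∀ k, ¬ ReflPrefixAt M a (m + 1) k) (hi : ReflPrefixAt M a m i) :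
    (fun t => if t < i then a t else M - a (t - i)) ∈ symShift M a := by
  set z : ℕ → ℕ := fun t => if t < i then a t else M - a (t - i) with hz
  have hza : ∀ t < i + m, z t = a t := by
    intro t ht
    by_cases h : t < i
    · simp [hz, h]
    · have := hi (t - i) (by omega)
      rw [show i + (t - i) = t by omega] at this
      simp [hz, h, this]
  refine ⟨fun t => ?_, fun s => ?_⟩
  · simp only [hz]
    split_ifs
    exacts [ha.1 t, Nat.sub_le _ _]
  · by_cases hs : s < i
    · have hzs : ∀ t < i + m - s, shift^[s] z t = shift^[s] a t := by
        intro t ht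
        rw [shift_iterate_apply, shift_iterate_apply, hza _ (by omega)]
      refine ⟨(ha.2 s).1.congr_right (N := m + 1) (fun t ht => hzs t (by omega)) fun h => ?_, ?_⟩
      · refine hm s fun t ht => ?_
        rw [← shift_iterate_apply a, h t ht, reflSeq]
      · refine Or.inr (lexLT.trans_lexLE ⟨i + m - s, hzs, ?_⟩ (ha.2 s).2)
        rw [shift_iterate_apply, shift_iterate_apply, show s + (i + m - s) = i + m by omega]
        simpa [hz] using lt_of_reflPrefixAt ha hi (hm i)
    · have hzs : shift^[s] z = shift^[s - i] (reflSeq M a) := by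
        funext t
        rw [shift_iterate_apply, shift_iterate_apply]
        simp only [hz, show ¬ s + t < i by omega, if_false, reflSeq]
        rw [show s + t - i = s - i + t by omega]
      rw [hzs]
      exact (reflSeq_mem_symShift ha).2 _

theorem exists_pos_reflPrefixAt {M m : ℕ} {a : ℕ → ℕ} (ha : memV M a)
    (hm : ∀ k, ¬ ReflPrefixAt M a (m + 1) k) (hex : ∃ i, ReflPrefixAt M a m i) :
    ∃ i, 1 ≤ i ∧ ReflPrefixAt M a m i := by
  obtain ⟨i, hi⟩ := hex
  rcases Nat.eq_zero_or_pos i with rfl | hpos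
  · rcases Nat.eq_zero_or_pos m with rfl | hmpos
    · exact ⟨1, le_rfl, fun t ht => absurd ht (Nat.not_lt_zero t)⟩
    · have h0 := hi 0 hmpos
      have hlt := lt_of_reflPrefixAt ha hi (hm 0)
      have hle : a m ≤ a 0 := by
        rcases (ha.2 m).2 with h | ⟨p, hp, hp'⟩
        · simpa [shift_iterate_apply] using (congrFun h 0).le
        · rcases Nat.eq_zero_or_pos p with rfl | hp0
          · simpa [shift_iterate_apply] using hp'.le
          · simpa [shift_iterate_apply] using (hp 0 hp0).le
      have hM := ha.1 0
      simp only [zero_add] at h0 hlt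
      omega
  · exact ⟨i, hpos, hi⟩

/-- If some reflected prefix of `a` does not occur in `a`, then `symShift M a` is not covered by
the factors of `a` and of its reflection. -/
theorem exists_prefix_not_factor {M n : ℕ} {a : ℕ → ℕ} (ha : memV M a)
    (hn : ∀ k, ¬ ReflPrefixAt M a n k) :
    ∃ x ∈ symShift M a, ∃ N, (¬ ∃ k, ∀ i < N, a (k + i) = x i) ∧
      ¬ ∃ k, ∀ i < N, reflSeq M a (k + i) = x i := by
  by_contra! H
  have hmin := Nat.find_spec (⟨n, hn⟩ : ∃ n, ∀ k, ¬ ReflPrefixAt M a n k)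
  have hmin' := fun l => Nat.find_min (⟨n, hn⟩ : ∃ n, ∀ k, ¬ ReflPrefixAt M a n k) (m := l)
  generalize Nat.find (⟨n, hn⟩ : ∃ n, ∀ k, ¬ ReflPrefixAt M a n k) = m' at hmin hmin'
  obtain _ | m := m'
  · exact hmin 0 fun t ht => absurd ht (Nat.not_lt_zero t)
  have hex : ∃ i, ReflPrefixAt M a m i := by
    simpa using hmin' m (Nat.lt_succ_self m)
  have hglue : ∀ i, ReflPrefixAt M a m i → ∃ k, ∀ s < 2 * i + m + 1,
      M - a (k + s) = if s < i then a s else M - a (s - i) := by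
    intro i hi
    by_contra hcon
    have hfac : ∃ k, ∀ s < 2 * i + m + 1,
        a (k + s) = if s < i then a s else M - a (s - i) := by
      by_contra hcon'
      obtain ⟨k, hk⟩ := H _ (prefix_append_reflSeq_mem ha hmin hi) (2 * i + m + 1)
        (by simpa using hcon')
      exact hcon ⟨k, hk⟩
    obtain ⟨k, hk⟩ := hfac
    refine hmin (k + i) fun t ht => ?_
    have := hk (i + t) (by omega)
    rwa [if_neg (by omega), Nat.add_sub_cancel_left, ← add_assoc] at this
  have hlarge : ∀ K, ∃ i, K + 1 ≤ i ∧ ReflPrefixAt M a m i := by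
    intro K
    induction K with
    | zero => simpa using exists_pos_reflPrefixAt ha hmin hex
    | succ K ih =>
      obtain ⟨i, hKi, hi⟩ := ih
      obtain ⟨k, hk⟩ := hglue i hi
      refine ⟨k + 2 * i, by omega, fun t ht => ?_⟩
      have h1 := hk (2 * i + t) (by omega)
      rw [if_neg (by omega), show 2 * i + t - i = i + t by omega, ← add_assoc] at h1
      have h2 := hi t ht
      have h3 := ha.1 (k + 2 * i + t)
      have h4 := ha.1 (i + t)
      omega
  obtain ⟨i, hmi, hi⟩ := hlarge m
  obtain ⟨k, hk⟩ := hglue i hi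
  refine hmin k fun t ht => ?_
  have h1 := hk t (by omega)
  rw [if_pos (by omega)] at h1
  have := ha.1 (k + t)
  omega

theorem isFactorOf_prefixWord_iff {x b : ℕ → ℕ} {N : ℕ} :
    IsFactorOf (prefixWord x N) b ↔ ∃ k, ∀ i < N, b (k + i) = x i := by
  refine exists_congr fun k => ?_
  simp only [prefixWord, List.length_map, List.length_range]
  refine forall₂_congr fun i hi => ?_
  rw [List.getD_eq_getElem _ _ (by simpa using hi)]
  simp

theorem exists_inLang_not_isFactorOf {M : ℕ} {a : ℕ → ℕ} (ha : memV M a)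
    (hnd : ¬ symShift M a ⊆ closure (orbit a)) :
    ∃ w, InLang (symShift M a) w ∧ ¬ IsFactorOf w a ∧ ¬ IsFactorOf w (reflSeq M a) := by
  suffices h : ∃ x ∈ symShift M a, ∃ N, (¬ ∃ k, ∀ i < N, a (k + i) = x i) ∧
      ¬ ∃ k, ∀ i < N, reflSeq M a (k + i) = x i by
    obtain ⟨x, hx, N, h1, h2⟩ := h
    exact ⟨prefixWord x N, ⟨x, hx, isFactorOf_prefixWord_iff.2 ⟨0, by simp⟩⟩,
      mt isFactorOf_prefixWord_iff.1 h1, mt isFactorOf_prefixWord_iff.1 h2⟩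
  obtain ⟨y, hy, hyc⟩ := Set.not_subset.1 hnd
  obtain ⟨N, hN⟩ := not_forall.1 (mt mem_closure_orbit hyc)
  by_cases hr : ∃ k, ∀ i < N, reflSeq M a (k + i) = y i
  · obtain ⟨k, hk⟩ := hr
    refine exists_prefix_not_factor ha (n := k + N) fun l hl => hN ⟨l + k, fun i hi => ?_⟩
    rw [← hk i hi, reflSeq, add_assoc, hl (k + i) (by omega)]
  · exact ⟨y, hy, N, hN, hr⟩

/-- If `α(q)` is irreducible and its orbit is not dense in `V_q`, then
`L(V_q)` contains an intrinsically synchronising word; moreover every admissible word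
which is a factor of neither `α(q)` nor `ᾱ(q)` is intrinsically synchronising. -/
theorem synchronising_word_of_not_dense (M : ℕ) (hM : 1 ≤ M) (q : ℝ)
    (hqVL : memVL M q) (hirr : IrreducibleSeq M (qg M q))
    (hnd : ¬ (Vq M q ⊆ closure (orbit (qg M q)))) :
    (∃ w : List ℕ, InLang (Vq M q) w ∧ IntrinsicallySynchronising (Vq M q) w) ∧
      ∀ w : List ℕ, InLang (Vq M q) w → ¬ IsFactorOf w (qg M q) →
        ¬ IsFactorOf w (reflSeq M (qg M q)) →
          IntrinsicallySynchronising (Vq M q) w := by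
  have hsync : ∀ w : List ℕ, ¬ IsFactorOf w (qg M q) → ¬ IsFactorOf w (reflSeq M (qg M q)) →
      IntrinsicallySynchronising (Vq M q) w := fun w hw hw' =>
    intrinsicallySynchronising_of_not_isFactorOf hw hw'
  refine ⟨?_, fun w _ => hsync w⟩
  obtain ⟨w, hw, h1, h2⟩ := exists_inLang_not_isFactorOf hqVL.2.2 hnd
  exact ⟨w, hw, hsync w h1 h2⟩
end
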